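/- Let G be a finite group, p a prime, and α a positive integer. Then vcs(G) = {p^α} if and only if G = PH, where P is a normal Sylow p-subgroup of G and H is an abelian p-complement of G, and one of the following occurs: (a) H centralizes P (so that G = P × H internally) and cs(P) = {1, p^α}; (b) G/Z(G) is a Frobenius group with kernel PZ(G)/Z(G) of order p^α and complement HZ(G)/Z(G), and P contains no vanishing elements of G. -/

import Mathlib

open scoped Classical

noncomputable section

/-- `g` is a vanishing element of `G`: some irreducible complex character of `G`
takes the value `0` at `g`. -/
def IsVanishing (G : Type) [Group G] (g : G) : Prop :=
  ∃ V : FDRep ℂ G, CategoryTheory.Simple V ∧ V.character g = 0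

/-- The conjugacy class size of `g`, i.e. `|G : C_G(g)|`. -/
def classSize {G : Type*} [Group G] (g : G) : ℕ := (Subgroup.centralizer {g}).index

/-- The set of conjugacy class sizes of vanishing elements of `G`. -/
def vcs (G : Type) [Group G] : Set ℕ :=
  {n | ∃ g : G, IsVanishing G g ∧ classSize g = n}

/-- The set of conjugacy class sizes of `G`. -/
def cs (G : Type*) [Group G] : Set ℕ := {n | ∃ g : G, classSize g = n}

/-- `H` is a Hall `π`-subgroup of `G`. -/
def IsHallSubgroup {G : Type*} [Group G] (π : Set ℕ) (H : Subgroup G) : Prop :=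
  (∀ p : ℕ, p.Prime → p ∣ Nat.card H → p ∈ π) ∧
  (∀ p : ℕ, p.Prime → p ∣ H.index → p ∉ π)

/-- The set of prime divisors of `n`. -/
def primesOf (n : ℕ) : Set ℕ := {p | p.Prime ∧ p ∣ n}

/-- The `π`-part `n_π` of `n`: the largest divisor of `n` all of whose prime
factors lie in `π`. -/
noncomputable def piPart (π : Set ℕ) (n : ℕ) : ℕ :=
  ∏ p ∈ n.primeFactors, p ^ (if p ∈ π then n.factorization p else 0)

/-- The subgroup `H` is abelian. -/
def IsAbelianSubgroup {G : Type*} [Group G] (H : Subgroup G) : Prop :=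
  ∀ a ∈ H, ∀ b ∈ H, a * b = b * a

/-- `X` is a Frobenius group with kernel `K`: `K` is a nontrivial proper normal
subgroup and the centralizer of every nontrivial element of `K` lies in `K`. -/
def IsFrobeniusWithKernel {X : Type*} [Group X] (K : Subgroup X) : Prop :=
  K ≠ ⊥ ∧ K ≠ ⊤ ∧ K.Normal ∧ ∀ k ∈ K, k ≠ 1 → Subgroup.centralizer {k} ≤ K

/-- `X` is a Frobenius group with kernel `K` and complement `C`. -/
def IsFrobenius {X : Type*} [Group X] (K C : Subgroup X) : Prop :=
  IsFrobeniusWithKernel K ∧ K ⊔ C = ⊤ ∧ K ⊓ C = ⊥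

/-- `G` is supersolvable: there is a chain of subgroups from `⊥` to `⊤`, each
normal in `G`, with all successive quotients cyclic (equivalently, each term is
generated by the previous one together with a single element). -/
def IsSupersolvable (G : Type*) [Group G] : Prop :=
  ∃ (n : ℕ) (c : Fin (n + 1) → Subgroup G),
    c 0 = ⊥ ∧ c (Fin.last n) = ⊤ ∧
    (∀ i : Fin n, c i.castSucc ≤ c i.succ) ∧
    (∀ i : Fin (n + 1), (c i).Normal) ∧
    (∀ i : Fin n, ∃ g : G, c i.castSucc ⊔ Subgroup.zpowers g = c i.succ)

/-- The Fitting subgroup of `G`: the subgroup generated by all nilpotent normal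
subgroups of `G`. -/
def Fitting (G : Type*) [Group G] : Subgroup G :=
  ⨆ H ∈ {H : Subgroup G | H.Normal ∧ Group.IsNilpotent ↥H}, H

/-- `O_p(G)`: the subgroup generated by all normal `p`-subgroups of `G`
(the largest normal `p`-subgroup). -/
def pCore' (p : ℕ) (G : Type*) [Group G] : Subgroup G :=
  ⨆ K ∈ {K : Subgroup G | K.Normal ∧ IsPGroup p ↥K}, K

section

open Representation

section Characters

variable {G V W : Type} [Group G] [AddCommGroup V] [Module ℂ V] [AddCommGroup W] [Module ℂ W]
  (ρ : Representation ℂ G V) (σ : Representation ℂ G W)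

theorem isIrreducible_iff_forall_submodule :
    ρ.IsIrreducible ↔ Nontrivial V ∧
      ∀ U : Submodule ℂ V, (∀ g, ∀ v ∈ U, ρ g v ∈ U) → U = ⊥ ∨ U = ⊤ := by
  constructor
  · intro h
    refine ⟨?_, fun U hU ↦ ?_⟩
    · by_contra hV
      rw [not_nontrivial_iff_subsingleton] at hV
      have h1 : (⊥ : Subrepresentation ρ) ≠ ⊤ := bot_ne_top
      exact h1 (Subrepresentation.toSubmodule_injective (Subsingleton.elim _ _))
    · rcases h.eq_bot_or_eq_top (⟨U, fun g v hv ↦ hU g v hv⟩ : Subrepresentation ρ) with h1 | h1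
      · left; exact congrArg Subrepresentation.toSubmodule h1
      · right; exact congrArg Subrepresentation.toSubmodule h1
  · rintro ⟨hV, hU⟩
    exact
      { exists_pair_ne := ⟨⊥, ⊤, fun h ↦ bot_ne_top (α := Submodule ℂ V)
          (congrArg Subrepresentation.toSubmodule h)⟩
        eq_bot_or_eq_top := fun S ↦ by
          rcases hU S.toSubmodule (fun g v hv ↦ S.apply_mem_toSubmodule g hv) with h | h
          · left; exact Subrepresentation.toSubmodule_injective h
          · right; exact Subrepresentation.toSubmodule_injective h }

set_option linter.unusedSectionVars false

variable [FiniteDimensional ℂ V] [FiniteDimensional ℂ W]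

theorem sum_char_mul_char_inv [Fintype G] :
    ∑ g : G, σ.character g * ρ.character g⁻¹ =
      Nat.card G * Module.finrank ℂ (IntertwiningMap ρ σ) := by
  have h0 : (Nat.card G : ℂ) ≠ 0 := Nat.cast_ne_zero.2 Nat.card_pos.ne'
  have := invertibleOfNonzero h0
  rw [← card_inv_mul_sum_char_mul_char_eq_finrank, mul_inv_cancel_left₀ h0]

theorem exists_isCompl_invariant [Finite G] (U : Submodule ℂ V) (hU : ∀ g, ∀ v ∈ U, ρ g v ∈ U) :
    ∃ U' : Submodule ℂ V, (∀ g, ∀ v ∈ U', ρ g v ∈ U') ∧ IsCompl U U' := by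
  have : NeZero (Nat.card G : ℂ) := ⟨Nat.cast_ne_zero.2 Nat.card_pos.ne'⟩
  have hss : IsSemisimpleRepresentation ρ := inferInstance
  obtain ⟨S, hS⟩ := hss.exists_isCompl
    (⟨U, fun g v hv ↦ hU g v hv⟩ : Subrepresentation ρ)
  refine ⟨S.toSubmodule, fun g v hv ↦ S.apply_mem_toSubmodule g hv, ?_, ?_⟩
  · rw [disjoint_iff]
    exact congrArg Subrepresentation.toSubmodule (disjoint_iff.1 hS.1)
  · rw [codisjoint_iff]
    exact congrArg Subrepresentation.toSubmodule (codisjoint_iff.1 hS.2)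

theorem isIrreducible_of_finrank_intertwiningMap_eq_one [Finite G]
    (h : Module.finrank ℂ (IntertwiningMap ρ ρ) = 1) : ρ.IsIrreducible := by
  have hspan : ∀ f : V →ₗ[ℂ] V, (∀ g v, f (ρ g v) = ρ g (f v)) → ∃ c : ℂ, ∀ v, f v = c • v := by
    intro f hf
    by_cases hid : IntertwiningMap.id ρ = 0
    · refine ⟨0, fun v ↦ ?_⟩
      have hv : v = 0 := congrArg (fun F : IntertwiningMap ρ ρ ↦ F v) hid
      simp [hv]
    · obtain ⟨c, hc⟩ := (finrank_eq_one_iff_of_nonzero' _ hid).1 h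
        (f.intertwiningMap_of_isIntertwiningMap ρ ρ hf)
      exact ⟨c, fun v ↦ (congrArg (fun F : IntertwiningMap ρ ρ ↦ F v) hc).symm⟩
  rw [isIrreducible_iff_forall_submodule]
  constructor
  · by_contra hV
    rw [not_nontrivial_iff_subsingleton] at hV
    have : Subsingleton (IntertwiningMap ρ ρ) :=
      ⟨fun f g ↦ IntertwiningMap.ext (LinearMap.ext fun v ↦ Subsingleton.elim _ _)⟩
    rw [Module.finrank_zero_of_subsingleton] at h
    omega
  · intro U hU
    obtain ⟨U', hU', hc⟩ := exists_isCompl_invariant ρ U hU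
    obtain ⟨c, hc'⟩ := hspan (U.subtype ∘ₗ U.projectionOnto U' hc) (by
      intro g v
      obtain ⟨a, b, rfl⟩ : ∃ a : U, ∃ b : U', (a : V) + b = v :=
        ⟨_, _, congrArg (fun f : V ≃ₗ[ℂ] V ↦ f v)
          (show (U.prodEquivOfIsCompl U' hc).symm.trans (U.prodEquivOfIsCompl U' hc) =
            LinearEquiv.refl ℂ V by simp)⟩
      have h1 : ρ g ((a : V) + b) = ((⟨ρ g a, hU g a a.2⟩ : U) : V) +
          ((⟨ρ g b, hU' g b b.2⟩ : U') : V) := by simp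
      simp only [LinearMap.comp_apply, Submodule.subtype_apply]
      rw [h1, map_add, map_add, Submodule.projectionOnto_apply_left,
        Submodule.projectionOnto_apply_right, Submodule.projectionOnto_apply_left,
        Submodule.projectionOnto_apply_right]
      simp)
    simp only [LinearMap.comp_apply, Submodule.subtype_apply] at hc'
    by_cases hc0 : c = 0
    · left
      rw [eq_bot_iff]
      intro v hv
      have := hc' v
      rw [show v = ((⟨v, hv⟩ : U) : V) from rfl, Submodule.projectionOnto_apply_left] at this
      simpa [hc0] using this
    · right
      have : U' = ⊥ := by
        rw [eq_bot_iff]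
        intro v hv
        have := hc' v
        rw [show v = ((⟨v, hv⟩ : U') : V) from rfl,
          Submodule.projectionOnto_apply_right] at this
        have h2 : c • v = 0 := by simpa using this.symm
        exact (smul_eq_zero.1 h2).resolve_left hc0
      rw [this] at hc
      exact eq_top_of_isCompl_bot hc

theorem IsVanishing.of_isIrreducible [Finite G] (h : ρ.IsIrreducible) {g : G}
    (hg : ρ.character g = 0) : IsVanishing G g := by
  have := Fintype.ofFinite G
  refine ⟨FDRep.of ρ, ?_, hg⟩
  rw [FDRep.simple_iff_char_is_norm_one]
  have h1 := sum_char_mul_char_inv ρ ρ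
  rw [IsIrreducible.finrank_intertwiningMap_self ρ] at h1
  rw [Nat.cast_one, mul_one] at h1
  exact h1

theorem IsVanishing.exists_representation [Finite G] {g : G} (hg : IsVanishing G g) :
    ∃ (V : Type) (_ : AddCommGroup V) (_ : Module ℂ V) (_ : FiniteDimensional ℂ V)
      (ρ : Representation ℂ G V), ρ.IsIrreducible ∧ ρ.character g = 0 := by
  have := Fintype.ofFinite G
  obtain ⟨V, hV, h0⟩ := hg
  let ρ : Representation ℂ G V := V.ρ
  refine ⟨V, inferInstance, inferInstance, inferInstance, ρ, ?_, h0⟩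
  apply isIrreducible_of_finrank_intertwiningMap_eq_one
  rw [FDRep.simple_iff_char_is_norm_one] at hV
  have h1 := sum_char_mul_char_inv ρ ρ
  have h2 : ∑ g : G, ρ.character g * ρ.character g⁻¹ = (Nat.card G : ℂ) := hV
  rw [h2] at h1
  have h0 : (Nat.card G : ℂ) ≠ 0 := Nat.cast_ne_zero.2 Nat.card_pos.ne'
  have h3 : (Module.finrank ℂ (IntertwiningMap ρ ρ) : ℂ) = 1 := by
    field_simp at h1
    exact h1.symm
  exact_mod_cast h3

/-- An irreducible representation pulled back along a surjection is irreducible. -/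
theorem isIrreducible_comp_of_surjective {K : Type} [Group K] (f : K →* G)
    (hf : Function.Surjective f) (h : ρ.IsIrreducible) :
    Representation.IsIrreducible (ρ.comp f) := by
  rw [isIrreducible_iff_forall_submodule] at h ⊢
  refine ⟨h.1, fun U hU ↦ h.2 U fun g v hv ↦ ?_⟩
  obtain ⟨k, rfl⟩ := hf g
  exact hU k v hv

theorem IsVanishing.of_surjective {K : Type} [Group K] [Finite K] (f : K →* G)
    (hf : Function.Surjective f) {k : K} (hk : IsVanishing G (f k)) : IsVanishing K k := by
  have : Finite G := Finite.of_surjective f hf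
  obtain ⟨V, _, _, _, ρ, hρ, h0⟩ := hk.exists_representation
  exact IsVanishing.of_isIrreducible _ (isIrreducible_comp_of_surjective ρ f hf hρ) h0

/-- Schur's lemma. -/
theorem exists_smul_of_commute (h : ρ.IsIrreducible) (f : V →ₗ[ℂ] V)
    (hf : ∀ g v, f (ρ g v) = ρ g (f v)) : ∃ c : ℂ, ∀ v, f v = c • v := by
  let F := f.intertwiningMap_of_isIntertwiningMap ρ ρ hf
  obtain ⟨c, hc⟩ := (IsIrreducible.algebraMap_intertwiningMap_bijective_of_isAlgClosed (ρ := ρ)).2 F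
  refine ⟨c, fun v ↦ ?_⟩
  have := congrArg (fun F : IntertwiningMap ρ ρ ↦ F v) hc
  rw [Algebra.algebraMap_eq_smul_one] at this
  exact this.symm

theorem exists_smul_of_mem_center (h : ρ.IsIrreducible) {z : G} (hz : z ∈ Subgroup.center G) :
    ∃ c : ℂ, c ≠ 0 ∧ ∀ v, ρ z v = c • v := by
  obtain ⟨c, hc⟩ := exists_smul_of_commute ρ h (ρ z) (fun g v ↦ by
    rw [← Module.End.mul_apply, ← Module.End.mul_apply, ← map_mul, ← map_mul,
      (Subgroup.mem_center_iff.1 hz g)])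
  refine ⟨c, ?_, hc⟩
  rintro rfl
  obtain ⟨v, hv⟩ := @exists_ne V ((isIrreducible_iff_forall_submodule ρ).1 h).1 0
  apply hv
  have : ρ z⁻¹ (ρ z v) = v := by
    rw [← Module.End.mul_apply, ← map_mul]; simp
  rw [← this, hc]; simp

end Characters

theorem IsVanishing.mul_mem_center {G : Type} [Group G] [Finite G] {g z : G}
    (hz : z ∈ Subgroup.center G) (h : IsVanishing G g) : IsVanishing G (g * z) := by
  obtain ⟨V, _, _, _, ρ, hρ, h0⟩ := h.exists_representation
  refine IsVanishing.of_isIrreducible ρ hρ ?_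
  obtain ⟨c, -, hc⟩ := exists_smul_of_mem_center ρ hρ hz
  have : ρ (g * z) = c • ρ g := by
    ext v
    simp [hc]
  rw [character] at h0 ⊢
  rw [this, map_smul, h0, smul_zero]

theorem not_isVanishing_of_mem_center {G : Type} [Group G] [Finite G] {z : G}
    (hz : z ∈ Subgroup.center G) : ¬ IsVanishing G z := by
  intro h
  have h1 := h.mul_mem_center (inv_mem hz)
  rw [mul_inv_cancel] at h1
  obtain ⟨V, _, _, _, ρ, hρ, h0⟩ := h1.exists_representation
  have := ((isIrreducible_iff_forall_submodule ρ).1 hρ).1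
  rw [char_one] at h0
  exact Module.finrank_pos.ne' (Nat.cast_eq_zero.1 h0)

section Eigenvalues

variable {G V : Type} [Group G] [Finite G] [AddCommGroup V] [Module ℂ V] [FiniteDimensional ℂ V]
  (ρ : Representation ℂ G V)

theorem exists_eigenbasis (g : G) : ∃ (ι : Type) (_ : Fintype ι) (b : Module.Basis ι ℂ V)
    (l : ι → ℂ), (∀ i, ρ g (b i) = l i • b i) ∧ ∀ i, l i ^ Nat.card G = 1 := by
  have hpow : (ρ g) ^ Nat.card G = 1 := by rw [← map_pow, pow_card_eq_one', map_one]
  have hss : Module.End.IsSemisimple (ρ g) := by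
    refine Module.End.isSemisimple_of_squarefree_aeval_eq_zero
      (p := (Polynomial.X ^ Nat.card G - 1 : Polynomial ℂ)) ?_ (by simp [hpow])
    exact (Polynomial.X_pow_sub_one_separable_iff.2
      (Nat.cast_ne_zero.2 Nat.card_pos.ne')).squarefree
  have hspan : ⊤ ≤ Submodule.span ℂ {v : V | ∃ μ : ℂ, ρ g v = μ • v} := by
    rw [← hss.iSup_eigenspace_eq_top, iSup_le_iff]
    intro μ v hv
    exact Submodule.subset_span ⟨μ, Module.End.mem_eigenspace_iff.1 hv⟩
  let b := Module.Basis.ofSpan hspan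
  have hb : ∀ i, ∃ μ : ℂ, ρ g (b i) = μ • b i := fun i ↦
    Module.Basis.ofSpan_subset hspan ⟨i, rfl⟩
  choose l hl using hb
  have := Module.Finite.finite_basis b
  refine ⟨_, Fintype.ofFinite _, b, l, hl, fun i ↦ ?_⟩
  have h1 : ∀ m : ℕ, ((ρ g) ^ m) (b i) = l i ^ m • b i := by
    intro m
    induction m with
    | zero => simp
    | succ m ih => rw [pow_succ', Module.End.mul_apply, ih, map_smul, hl, smul_smul, pow_succ]
  have h2 := h1 (Nat.card G)
  rw [hpow, Module.End.one_apply] at h2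
  have h3 : (l i ^ Nat.card G - 1) • b i = 0 := by rw [sub_smul, ← h2, one_smul, sub_self]
  exact sub_eq_zero.1 ((smul_eq_zero.1 h3).resolve_right (b.ne_zero i))

omit [Finite G] [FiniteDimensional ℂ V] in
theorem character_eq_sum_of_basis {ι : Type} [Fintype ι] (b : Module.Basis ι ℂ V) (l : ι → ℂ)
    (g : G) (h : ∀ i, ρ g (b i) = l i • b i) : ρ.character g = ∑ i, l i := by
  rw [character, LinearMap.trace_eq_matrix_trace ℂ b, Matrix.trace]
  refine Finset.sum_congr rfl fun i _ ↦ ?_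
  simp [LinearMap.toMatrix_apply, h]

omit [Finite G] [FiniteDimensional ℂ V] in
theorem apply_pow_of_basis {ι : Type} (b : Module.Basis ι ℂ V) (l : ι → ℂ)
    (g : G) (h : ∀ i, ρ g (b i) = l i • b i) (m : ℕ) (i : ι) :
    ρ (g ^ m) (b i) = l i ^ m • b i := by
  induction m with
  | zero => simp
  | succ m ih =>
    rw [pow_succ', map_mul, Module.End.mul_apply, ih, map_smul, h, smul_smul, pow_succ]

theorem norm_eq_one_of_pow_card {n : ℕ} (hn : n ≠ 0) {z : ℂ} (h : z ^ n = 1) : ‖z‖ = 1 :=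
  Complex.norm_eq_one_of_pow_eq_one h hn

theorem character_inv (g : G) : ρ.character g⁻¹ = starRingEnd ℂ (ρ.character g) := by
  obtain ⟨ι, _, b, l, hb, hl⟩ := exists_eigenbasis ρ g
  rw [character_eq_sum_of_basis ρ b l g hb, character_eq_sum_of_basis ρ b (fun i ↦ (l i)⁻¹) g⁻¹,
    map_sum]
  · refine Finset.sum_congr rfl fun i _ ↦ ?_
    rw [Complex.inv_def, Complex.normSq_eq_norm_sq,
      norm_eq_one_of_pow_card Nat.card_pos.ne' (hl i)]
    simp
  · intro i
    have h0 : l i ≠ 0 := by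
      intro h; have := hl i; rw [h, zero_pow Nat.card_pos.ne'] at this; simp at this
    have : ρ g⁻¹ (ρ g (b i)) = b i := by rw [← Module.End.mul_apply, ← map_mul]; simp
    rw [hb, map_smul] at this
    rw [← this, smul_smul, inv_mul_cancel₀ h0, one_smul]
    exact this.symm ▸ rfl

theorem sum_norm_sq_character_subgroup (C : Subgroup G) [Fintype C] :
    ∑ g : C, ‖ρ.character g‖ ^ 2 = Nat.card C *
      Module.finrank ℂ (IntertwiningMap (ρ.comp C.subtype) (ρ.comp C.subtype)) := by
  have h := sum_char_mul_char_inv (G := C) (ρ.comp C.subtype) (ρ.comp C.subtype)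
  have h2 : ∀ g : C, character (ρ.comp C.subtype) g * character (ρ.comp C.subtype) g⁻¹ =
      ((‖ρ.character g‖ ^ 2 : ℝ) : ℂ) := by
    intro g
    have h3 : character (ρ.comp C.subtype) g⁻¹ = ρ.character (g : G)⁻¹ := rfl
    have h4 : character (ρ.comp C.subtype) g = ρ.character (g : G) := rfl
    rw [h3, h4, character_inv, Complex.mul_conj, Complex.normSq_eq_norm_sq]
  simp_rw [h2] at h
  exact_mod_cast h

theorem sum_norm_sq_character [Fintype G] (h : ρ.IsIrreducible) :
    ∑ g : G, ‖ρ.character g‖ ^ 2 = Nat.card G := by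
  have h1 := sum_char_mul_char_inv ρ ρ
  rw [IsIrreducible.finrank_intertwiningMap_self] at h1
  simp_rw [character_inv, Complex.mul_conj, Complex.normSq_eq_norm_sq] at h1
  rw [Nat.cast_one, mul_one] at h1
  exact_mod_cast h1

/-- The values of all characters of `G` at a fixed element are images of an algebraic integer of
the cyclotomic field, and its conjugates are the values at the powers coprime to `|G|`. -/
theorem exists_galois_data (G : Type) [Group G] [Finite G] :
    ∃ (K : Type) (_ : Field K) (_ : NumberField K) (j : (K →ₐ[ℚ] ℂ) → ℕ) (τ : K →ₐ[ℚ] ℂ),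
      j τ = 1 ∧ (∀ σ, (j σ).Coprime (Nat.card G)) ∧
      ∀ (V : Type) [AddCommGroup V] [Module ℂ V] [FiniteDimensional ℂ V]
        (ρ : Representation ℂ G V) (g : G), ∃ x : K, IsIntegral ℤ x ∧
          ∀ σ, σ x = ρ.character (g ^ j σ) := by
  have : NeZero (Nat.card G) := ⟨Nat.card_pos.ne'⟩
  have : NeZero ((Nat.card G : ℕ) : ℚ) := ⟨Nat.cast_ne_zero.2 Nat.card_pos.ne'⟩
  let K := CyclotomicField (Nat.card G) ℚ
  have : IsCyclotomicExtension {Nat.card G} ℚ K :=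
    CyclotomicField.isCyclotomicExtension (Nat.card G) ℚ
  let z : K := IsCyclotomicExtension.zeta (Nat.card G) ℚ K
  have hz : IsPrimitiveRoot z (Nat.card G) := IsCyclotomicExtension.zeta_spec (Nat.card G) ℚ K
  let τ : K →ₐ[ℚ] ℂ := IsAlgClosed.lift
  have hτ : IsPrimitiveRoot (τ z) (Nat.card G) := hz.map_of_injective τ.injective
  have hex : ∀ σ : K →ₐ[ℚ] ℂ, ∃ j : ℕ, j.Coprime (Nat.card G) ∧ σ z = τ z ^ j ∧
      (σ = τ → j = 1) := by
    intro σ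
    by_cases hσ : σ = τ
    · exact ⟨1, Nat.coprime_one_left _, by rw [hσ, pow_one], fun _ ↦ rfl⟩
    · have h1 : IsPrimitiveRoot (σ z) (Nat.card G) := hz.map_of_injective σ.injective
      obtain ⟨i, -, hi⟩ := hτ.eq_pow_of_pow_eq_one h1.pow_eq_one
      refine ⟨i, ?_, hi.symm, fun h ↦ absurd h hσ⟩
      rw [← hi] at h1
      exact (hτ.pow_iff_coprime Nat.card_pos i).1 h1
  choose j hj1 hj2 hj3 using hex
  refine ⟨K, inferInstance, inferInstance, j, τ, hj3 τ rfl, hj1, ?_⟩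
  intro V _ _ _ ρ g
  obtain ⟨ι, _, b, l, hb, hl⟩ := exists_eigenbasis ρ g
  choose a _ ha using fun i ↦ hτ.eq_pow_of_pow_eq_one (hl i)
  refine ⟨∑ i, z ^ a i, IsIntegral.sum _ fun i _ ↦ (hz.isIntegral Nat.card_pos).pow _,
    fun σ ↦ ?_⟩
  rw [character_eq_sum_of_basis ρ b (fun i ↦ l i ^ j σ) (g ^ j σ)
    (fun i ↦ apply_pow_of_basis ρ b l g hb _ i), map_sum]
  refine Finset.sum_congr rfl fun i _ ↦ ?_
  rw [map_pow, hj2, ← ha i, ← pow_mul, ← pow_mul, mul_comm]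

end Eigenvalues

section NumberFields

variable {K : Type} [Field K] [NumberField K]

theorem one_le_prod_norm_embeddings {x : K} (hx : IsIntegral ℤ x) (h0 : x ≠ 0) :
    1 ≤ ∏ σ : K →ₐ[ℚ] ℂ, ‖σ x‖ := by
  rw [← norm_prod, ← Algebra.norm_eq_prod_embeddings ℚ ℂ x]
  obtain ⟨m, hm⟩ := IsIntegrallyClosed.isIntegral_iff.1 (Algebra.isIntegral_norm ℚ hx)
  have h1 : Algebra.norm ℚ x ≠ 0 := Algebra.norm_ne_zero_iff.2 h0
  have hm0 : m ≠ 0 := by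
    rintro rfl
    rw [map_zero] at hm
    exact h1 hm.symm
  rw [← hm]
  simp only [eq_intCast, map_intCast, Complex.norm_intCast]
  exact_mod_cast Int.one_le_abs hm0

theorem card_embeddings_le_sum_norm_sq {x : K} (hx : IsIntegral ℤ x) (h0 : x ≠ 0) :
    (Fintype.card (K →ₐ[ℚ] ℂ) : ℝ) ≤ ∑ σ : K →ₐ[ℚ] ℂ, ‖σ x‖ ^ 2 := by
  have hpos : ∀ σ : K →ₐ[ℚ] ℂ, 0 < ‖σ x‖ := fun σ ↦ norm_pos_iff.2 (by simpa using h0)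
  have h1 : ∀ σ : K →ₐ[ℚ] ℂ, 2 * Real.log ‖σ x‖ ≤ ‖σ x‖ ^ 2 - 1 := fun σ ↦ by
    have := Real.log_le_sub_one_of_pos (pow_pos (hpos σ) 2)
    rwa [Real.log_pow, Nat.cast_ofNat] at this
  have h2 := Finset.sum_le_sum fun σ (_ : σ ∈ Finset.univ) ↦ h1 σ
  rw [← Finset.mul_sum, ← Real.log_prod (fun σ _ ↦ (hpos σ).ne'), Finset.sum_sub_distrib] at h2
  have h3 := Real.log_nonneg (one_le_prod_norm_embeddings hx h0)
  simp only [Finset.sum_const, Finset.card_univ, nsmul_eq_mul, mul_one] at h2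
  linarith

end NumberFields

theorem card_le_of_forall_le_sum {ι E : Type} [Fintype E] [Nonempty E] (t : Finset ι)
    (a : ι → E → ℝ) (c : ℝ) (h1 : ∀ i ∈ t, (Fintype.card E : ℝ) ≤ ∑ e, a i e)
    (h2 : ∀ e, ∑ i ∈ t, a i e = c) : (t.card : ℝ) ≤ c := by
  have h3 := Finset.sum_le_sum h1
  rw [Finset.sum_comm, Finset.sum_congr rfl (fun e _ ↦ h2 e)] at h3
  simp only [Finset.sum_const, Finset.card_univ, nsmul_eq_mul] at h3
  have h4 : (0 : ℝ) < Fintype.card E := by exact_mod_cast Fintype.card_pos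
  nlinarith

section

variable {G V : Type} [Group G] [Finite G] [AddCommGroup V] [Module ℂ V] [FiniteDimensional ℂ V]
  (ρ : Representation ℂ G V)

theorem card_le_sum_norm_sq_character (S : Finset G)
    (hS : ∀ g ∈ S, ∀ j : ℕ, j.Coprime (Nat.card G) → g ^ j ∈ S)
    (h0 : ∀ g ∈ S, ρ.character g ≠ 0) :
    (S.card : ℝ) ≤ ∑ g ∈ S, ‖ρ.character g‖ ^ 2 := by
  obtain ⟨K, _, _, j, τ, -, hj, hx⟩ := exists_galois_data G
  choose x hx1 hx2 using fun g ↦ hx V ρ g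
  have : Nonempty (K →ₐ[ℚ] ℂ) := ⟨τ⟩
  refine card_le_of_forall_le_sum S (fun g (σ : K →ₐ[ℚ] ℂ) ↦ ‖σ (x g)‖ ^ 2) _ ?_ ?_
  · intro g hg
    refine card_embeddings_le_sum_norm_sq (hx1 g) fun h ↦ ?_
    apply h0 _ (hS g hg (j τ) (hj τ))
    rw [← hx2, h, map_zero]
  · intro σ
    have hinj : Function.Injective (fun g : G ↦ g ^ j σ) :=
      (powCoprime (G := G) (hj σ).symm).injective
    have himg : S.image (fun g : G ↦ g ^ j σ) = S := by
      apply Finset.eq_of_subset_of_card_le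
      · intro y hy
        obtain ⟨g, hg, rfl⟩ := Finset.mem_image.1 hy
        exact hS g hg _ (hj σ)
      · rw [Finset.card_image_of_injective _ hinj]
    conv_rhs => rw [← himg]
    rw [Finset.sum_image (fun a _ b _ h ↦ hinj h)]
    exact Finset.sum_congr rfl fun g _ ↦ by rw [hx2]

theorem exists_character_eq_zero (h : ρ.IsIrreducible) (hd : 1 < Module.finrank ℂ V) :
    ∃ g, ρ.character g = 0 := by
  by_contra! hne
  have := Fintype.ofFinite G
  have h1 := card_le_sum_norm_sq_character ρ (Finset.univ.erase 1) (fun g hg j hj ↦ by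
    rw [Finset.mem_erase] at hg ⊢
    refine ⟨fun h1 ↦ hg.1 ?_, Finset.mem_univ _⟩
    exact (powCoprime (G := G) hj.symm).injective (by simpa using h1)) (fun g _ ↦ hne g)
  have h2 := sum_norm_sq_character ρ h
  rw [← Finset.add_sum_erase _ _ (Finset.mem_univ 1), char_one] at h2
  rw [Finset.card_erase_of_mem (Finset.mem_univ _), Finset.card_univ,
    Nat.cast_sub Fintype.card_pos, ← Nat.card_eq_fintype_card] at h1
  have h3 : (1 : ℝ) < Module.finrank ℂ V := by exact_mod_cast hd
  rw [Complex.norm_natCast] at h2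
  push_cast at h1
  nlinarith

theorem classSize_eq_ncard {G : Type*} [Group G] (g : G) :
    classSize g = {y | IsConj g y}.ncard := by
  have h1 := MulAction.index_stabilizer (ConjAct G) g
  have h2 : MulAction.orbit (ConjAct G) g = {y | IsConj g y} := by
    ext y
    rw [ConjAct.mem_orbit_conjAct, Set.mem_ofPred_eq, isConj_comm]
  rw [h2] at h1
  rw [← h1, classSize]
  rw [ConjAct.stabilizer_eq_centralizer]
  rfl

theorem isIntegral_classSize_mul_character_div (h : ρ.IsIrreducible) (g : G) :
    IsIntegral ℤ ((classSize g : ℂ) * ρ.character g / Module.finrank ℂ V) := by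
  have := Fintype.ofFinite G
  have hV : Nontrivial V := ((isIrreducible_iff_forall_submodule ρ).1 h).1
  let S : Finset G := Finset.univ.filter fun y ↦ IsConj g y
  have hS : S.card = classSize g := by
    rw [classSize_eq_ncard, ← Set.ncard_coe_finset, Finset.coe_filter_univ]
  let c : MonoidAlgebra ℤ G := ∑ y ∈ S, MonoidAlgebra.of ℤ G y
  have : Module.Finite ℤ (MonoidAlgebra ℤ G) :=
    Module.Finite.equiv (MonoidAlgebra.coeffLinearEquiv ℤ).symm
  have hc : IsIntegral ℤ c := IsIntegral.of_finite ℤ c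
  let F : MonoidAlgebra ℤ G →ₐ[ℤ] Module.End ℂ V :=
    MonoidAlgebra.lift ℤ (Module.End ℂ V) G ρ
  have hF : F c = ∑ y ∈ S, ρ y := by
    simp [F, c, map_sum]
  obtain ⟨w, hw⟩ := exists_smul_of_commute ρ h (∑ y ∈ S, ρ y) (fun x v ↦ by
    simp only [LinearMap.sum_apply, map_sum]
    refine Finset.sum_bij' (fun y _ ↦ x⁻¹ * y * x) (fun y _ ↦ x * y * x⁻¹) ?_ ?_ ?_ ?_ ?_
    · intro y hy
      simp only [S, Finset.mem_filter_univ] at hy ⊢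
      exact hy.trans (isConj_iff.2 ⟨x⁻¹, by group⟩)
    · intro y hy
      simp only [S, Finset.mem_filter_univ] at hy ⊢
      exact hy.trans (isConj_iff.2 ⟨x, by group⟩)
    · intro y _; group
    · intro y _; group
    · intro y _
      simp only [← Module.End.mul_apply, ← map_mul]
      congr 2; group)
  have hFc : F c = algebraMap ℂ (Module.End ℂ V) w := by
    rw [hF]; ext v; rw [hw]; simp
  have hw2 : IsIntegral ℤ w := by
    have h1 : IsIntegral ℤ (F c) := hc.map F
    rw [hFc] at h1
    exact (isIntegral_algebraMap_iff (FaithfulSMul.algebraMap_injective ℂ (Module.End ℂ V))).1 h1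
  have htr : (classSize g : ℂ) * ρ.character g = w * Module.finrank ℂ V := by
    have h1 : LinearMap.trace ℂ V (∑ y ∈ S, ρ y) = w * Module.finrank ℂ V := by
      rw [show (∑ y ∈ S, ρ y) = w • (1 : Module.End ℂ V) from by ext v; rw [hw]; simp, map_smul,
        LinearMap.trace_one, smul_eq_mul]
    rw [← h1, map_sum, ← hS, ← nsmul_eq_mul]
    symm
    apply Finset.sum_eq_card_nsmul
    intro y hy
    simp only [S, Finset.mem_filter_univ] at hy
    obtain ⟨x, rfl⟩ := isConj_iff.1 hy
    exact char_conj ρ g x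
  have hd : (Module.finrank ℂ V : ℂ) ≠ 0 := Nat.cast_ne_zero.2 Module.finrank_pos.ne'
  rwa [htr, mul_div_cancel_right₀ _ hd]

theorem norm_character_le (g : G) : ‖ρ.character g‖ ≤ Module.finrank ℂ V := by
  obtain ⟨ι, _, b, l, hb, hl⟩ := exists_eigenbasis ρ g
  rw [character_eq_sum_of_basis ρ b l g hb, Module.finrank_eq_card_basis b]
  refine (norm_sum_le _ _).trans ?_
  rw [Finset.sum_congr rfl fun i _ ↦ norm_eq_one_of_pow_card Nat.card_pos.ne' (hl i)]
  simp

theorem exists_smul_of_norm_character_eq (g : G) (h : ‖ρ.character g‖ = Module.finrank ℂ V) :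
    ∃ c : ℂ, ∀ v, ρ g v = c • v := by
  obtain ⟨ι, _, b, l, hb, hl⟩ := exists_eigenbasis ρ g
  rw [character_eq_sum_of_basis ρ b l g hb, Module.finrank_eq_card_basis b] at h
  have hl1 : ∀ i, ‖l i‖ = 1 := fun i ↦ norm_eq_one_of_pow_card Nat.card_pos.ne' (hl i)
  set s := ∑ i, l i with hs
  by_cases hι : IsEmpty ι
  · refine ⟨0, fun v ↦ ?_⟩
    have : Subsingleton V := b.repr.toEquiv.subsingleton
    exact Subsingleton.elim _ _
  rw [not_isEmpty_iff] at hι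
  have hcard : (0 : ℝ) < Fintype.card ι := by exact_mod_cast Fintype.card_pos
  have hs0 : s ≠ 0 := by
    intro h0
    rw [h0, norm_zero] at h
    exact hcard.ne h
  have hre : ∀ i, (l i * starRingEnd ℂ s).re ≤ ‖s‖ := fun i ↦ by
    refine (Complex.re_le_norm _).trans ?_
    rw [norm_mul, hl1, one_mul, RCLike.norm_conj]
  have hsum : ∑ i, (l i * starRingEnd ℂ s).re = ∑ _i : ι, ‖s‖ := by
    rw [← Complex.re_sum, ← Finset.sum_mul, ← hs, Complex.mul_conj, Complex.ofReal_re,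
      Complex.normSq_eq_norm_sq]
    simp only [Finset.sum_const, Finset.card_univ, nsmul_eq_mul]
    rw [← h]
    ring
  have heq := (Finset.sum_eq_sum_iff_of_le (fun i _ ↦ hre i)).1 hsum
  have hli : ∀ i, l i = s / ‖s‖ := by
    intro i
    have h1 : (l i * starRingEnd ℂ s).re = ‖l i * starRingEnd ℂ s‖ := by
      rw [heq i (Finset.mem_univ _), norm_mul, hl1, one_mul, RCLike.norm_conj]
    have h2 : l i * starRingEnd ℂ s = (‖s‖ : ℂ) := by
      have h3 := Complex.eq_coe_norm_of_nonneg (z := l i * starRingEnd ℂ s) (by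
        rw [Complex.nonneg_iff]
        refine ⟨h1 ▸ norm_nonneg _, ?_⟩
        have h4 := Complex.abs_re_eq_norm.1 (show |(l i * starRingEnd ℂ s).re| = _ by
          rw [h1, abs_norm])
        exact h4.symm)
      rw [h3, norm_mul, hl1, one_mul, RCLike.norm_conj]
    have hn0 : (‖s‖ : ℂ) ≠ 0 := by exact_mod_cast norm_ne_zero_iff.2 hs0
    rw [eq_div_iff hn0]
    have h5 : starRingEnd ℂ s ≠ 0 := by simpa using hs0
    apply mul_right_cancel₀ h5
    rw [mul_right_comm, h2, Complex.mul_conj, Complex.normSq_eq_norm_sq]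
    push_cast; ring
  refine ⟨s / ‖s‖, fun v ↦ ?_⟩
  have : ρ g = (s / ‖s‖) • (1 : V →ₗ[ℂ] V) := b.ext fun i ↦ by simp [hb, hli]
  rw [this]; simp

/-- Burnside's lemma on character values at classes of size prime to the degree. -/
theorem character_eq_zero_or_exists_smul (h : ρ.IsIrreducible) (g : G)
    (hc : (classSize g).Coprime (Module.finrank ℂ V)) :
    ρ.character g = 0 ∨ ∃ c : ℂ, ∀ v, ρ g v = c • v := by
  by_contra! hcon
  obtain ⟨h0, hns⟩ := hcon
  have hV : Nontrivial V := ((isIrreducible_iff_forall_submodule ρ).1 h).1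
  have hdN : 0 < Module.finrank ℂ V := Module.finrank_pos
  set d := Module.finrank ℂ V with hd
  have hd0 : (d : ℂ) ≠ 0 := Nat.cast_ne_zero.2 hdN.ne'
  obtain ⟨K, _, _, j, τ, hτ, hj, hx⟩ := exists_galois_data G
  obtain ⟨x, hx1, hx2⟩ := hx V ρ g
  have h_int : IsIntegral ℤ (ρ.character g / d) := by
    have h1 := isIntegral_classSize_mul_character_div ρ h g
    have h2 : IsIntegral ℤ (ρ.character g) := by
      have := hx1.map (τ.restrictScalars ℤ)
      simpa [hx2, hτ] using this
    have h3 : ((classSize g).gcdA d : ℂ) * ((classSize g : ℂ) * ρ.character g / d) +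
        ((classSize g).gcdB d : ℂ) * ρ.character g = ρ.character g / d := by
      have h4 := Nat.gcd_eq_gcd_ab (classSize g) d
      rw [hc.gcd_eq_one] at h4
      have h5 : (1 : ℂ) = classSize g * (classSize g).gcdA d + d * (classSize g).gcdB d := by
        exact_mod_cast h4
      field_simp
      linear_combination -h5
    rw [← h3]
    have hZ : ∀ m : ℤ, IsIntegral ℤ (m : ℂ) := fun m ↦ by
      simpa using (isIntegral_algebraMap (R := ℤ) (A := ℂ) (x := m))
    exact ((hZ _).mul h1).add ((hZ _).mul h2)
  have hτ1 : τ (x / d) = ρ.character g / d := by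
    rw [map_div₀, hx2, hτ, pow_one, map_natCast]
  have hxi : IsIntegral ℤ (x / d) := by
    rw [← hτ1] at h_int
    exact (isIntegral_algHom_iff (τ.restrictScalars ℤ) τ.injective).1 h_int
  have hx0 : x / (d : K) ≠ 0 := by
    intro h1
    rw [h1, map_zero] at hτ1
    exact h0 ((div_eq_zero_iff.1 hτ1.symm).resolve_right hd0)
  have h6 := one_le_prod_norm_embeddings hxi hx0
  have hle : ∀ σ : K →ₐ[ℚ] ℂ, ‖σ (x / d)‖ ≤ 1 := fun σ ↦ by
    rw [map_div₀, hx2, map_natCast, norm_div, Complex.norm_natCast]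
    exact div_le_one_of_le₀ (norm_character_le ρ _) (Nat.cast_nonneg _)
  have hlt : ‖τ (x / d)‖ < 1 := by
    refine lt_of_le_of_ne (hle τ) fun h7 ↦ ?_
    rw [hτ1, norm_div, Complex.norm_natCast, div_eq_one_iff_eq (by exact_mod_cast hdN.ne')] at h7
    obtain ⟨c, hc⟩ := exists_smul_of_norm_character_eq ρ g h7
    obtain ⟨v, hv⟩ := hns c
    exact hv (hc v)
  rw [← Finset.mul_prod_erase _ _ (Finset.mem_univ τ)] at h6
  have h8 : ∏ σ ∈ Finset.univ.erase τ, ‖σ (x / d)‖ ≤ 1 :=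
    Finset.prod_le_one (fun σ _ ↦ norm_nonneg _) (fun σ _ ↦ hle σ)
  have h9 : 0 ≤ ∏ σ ∈ Finset.univ.erase τ, ‖σ (x / d)‖ :=
    Finset.prod_nonneg fun σ _ ↦ norm_nonneg _
  nlinarith [norm_nonneg (τ (x / d))]

end

section

variable {G V : Type} [Group G] [Finite G] [AddCommGroup V] [Module ℂ V] [FiniteDimensional ℂ V]
  (ρ : Representation ℂ G V)

omit [FiniteDimensional ℂ V] in
/-- If an irreducible character is constant on the coset `gE` of a normal subgroup acting
nontrivially, then it vanishes at `g`. -/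
theorem character_eq_zero_of_forall_mul (h : ρ.IsIrreducible) (E : Subgroup G) [E.Normal]
    (hE : ∃ e ∈ E, ρ e ≠ 1) (g : G) (hg : ∀ e ∈ E, ρ.character (g * e) = ρ.character g) :
    ρ.character g = 0 := by
  have := Fintype.ofFinite G
  let U : Submodule ℂ V :=
    { carrier := {v | ∀ e ∈ E, ρ e v = v}
      add_mem' := fun ha hb e he ↦ by rw [map_add, ha e he, hb e he]
      zero_mem' := fun e _ ↦ map_zero _
      smul_mem' := fun c v hv e he ↦ by rw [map_smul, hv e he] }
  have hU : U = ⊥ := by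
    refine (((isIrreducible_iff_forall_submodule ρ).1 h).2 U ?_).resolve_right ?_
    · intro x v hv e he
      have h1 := hv (x⁻¹ * e * x) (by simpa using ‹E.Normal›.conj_mem e he x⁻¹)
      calc ρ e (ρ x v) = ρ x (ρ (x⁻¹ * e * x) v) := by
            simp only [← Module.End.mul_apply, ← map_mul]; congr 2; group
        _ = ρ x v := by rw [h1]
    · intro hU
      obtain ⟨e, he, hne⟩ := hE
      apply hne
      ext v
      have : v ∈ U := hU ▸ Submodule.mem_top
      exact this e he
  have hT : ∑ e : E, ρ (e : G) = 0 := by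
    ext v
    have : (∑ e : E, ρ (e : G)) v ∈ U := by
      intro e he
      simp only [LinearMap.sum_apply, map_sum]
      refine Fintype.sum_equiv (Equiv.mulLeft (⟨e, he⟩ : E)) _ _ fun x ↦ ?_
      simp
    rw [hU] at this
    simpa using this
  have h1 : ∑ e : E, ρ.character (g * e) = 0 := by
    simp only [character, map_mul]
    rw [← map_sum, ← Finset.mul_sum, hT, mul_zero, map_zero]
  rw [Finset.sum_congr rfl fun (e : E) _ ↦ hg e e.2] at h1
  simpa using h1

/-- The Wedderburn decomposition of the group algebra as a family of irreducible representations,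
with the column orthogonality relations. -/
theorem exists_irreducible_family (G : Type) [Group G] [Fintype G] :
    ∃ (n : ℕ) (d : Fin n → ℕ) (ρ : ∀ i, Representation ℂ G (Fin (d i) → ℂ)),
      (∀ i, (ρ i).IsIrreducible) ∧ ∀ g h : G,
        ∑ i, (ρ i).character g * (ρ i).character h =
          ((Finset.univ.filter fun x ↦ g * x * h = x).card : ℂ) := by
  have : NeZero (Nat.card G : ℂ) := ⟨Nat.cast_ne_zero.2 Nat.card_pos.ne'⟩
  have hfin : Module.Finite ℂ (MonoidAlgebra ℂ G) :=
    Module.Finite.equiv (MonoidAlgebra.coeffLinearEquiv ℂ).symm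
  obtain ⟨n, d, hd, ⟨e⟩⟩ :=
    IsSemisimpleRing.exists_algEquiv_pi_matrix_of_isAlgClosed ℂ (MonoidAlgebra ℂ G)
  let ρ : ∀ i, Representation ℂ G (Fin (d i) → ℂ) := fun i ↦
    (((Matrix.toLinAlgEquiv' (R := ℂ) (n := Fin (d i))).toAlgHom.comp
      ((Pi.evalAlgHom ℂ _ i).comp e.toAlgHom) : MonoidAlgebra ℂ G →ₐ[ℂ] _) :
        MonoidAlgebra ℂ G →* _).comp (MonoidAlgebra.of ℂ G)
  have hρ : ∀ i g, ρ i g = Matrix.toLin' (e (MonoidAlgebra.of ℂ G g) i) := fun i g ↦ rfl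
  refine ⟨n, d, ρ, fun i ↦ ?_, fun g h ↦ ?_⟩
  · rw [isIrreducible_iff_forall_submodule]
    have := hd i
    refine ⟨inferInstance, fun U hU ↦ ?_⟩
    have hU2 : ∀ a : MonoidAlgebra ℂ G, ∀ v ∈ U, Matrix.toLin' (e a i) v ∈ U := by
      intro a v hv
      induction a using MonoidAlgebra.induction_linear with
      | zero => simp
      | add x y hx hy =>
        rw [map_add, Pi.add_apply, map_add, LinearMap.add_apply]
        exact U.add_mem hx hy
      | single g c =>
        have h1 : MonoidAlgebra.single g c = c • MonoidAlgebra.of ℂ G g := by simp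
        rw [h1, map_smul, Pi.smul_apply, map_smul, LinearMap.smul_apply]
        exact U.smul_mem c (hU g v hv)
    by_cases hbot : U = ⊥
    · exact Or.inl hbot
    right
    obtain ⟨u, hu, hu0⟩ := U.ne_bot_iff.1 hbot
    obtain ⟨k, hk⟩ := Function.ne_iff.1 hu0
    rw [eq_top_iff]
    intro w _
    let M : Matrix (Fin (d i)) (Fin (d i)) ℂ := Matrix.of fun a b ↦
      if b = k then w a / u k else 0
    have h1 := hU2 (e.symm (Pi.single i M)) u hu
    rw [AlgEquiv.apply_symm_apply, Pi.single_eq_same] at h1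
    convert h1 using 1
    ext a
    have hk' : u k ≠ 0 := hk
    simp [M, Matrix.mulVec, dotProduct, hk']
  · let T : MonoidAlgebra ℂ G →ₗ[ℂ] MonoidAlgebra ℂ G :=
      LinearMap.mulLeft ℂ (MonoidAlgebra.of ℂ G g) ∘ₗ LinearMap.mulRight ℂ (MonoidAlgebra.of ℂ G h)
    have h1 : LinearMap.trace ℂ _ T =
        ((Finset.univ.filter fun x ↦ g * x * h = x).card : ℂ) := by
      rw [LinearMap.trace_eq_matrix_trace ℂ (MonoidAlgebra.basis G ℂ), Matrix.trace,
        Finset.card_filter]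
      push_cast
      refine Finset.sum_congr rfl fun x _ ↦ ?_
      rw [Matrix.diag_apply, LinearMap.toMatrix_apply, MonoidAlgebra.basis_apply]
      have : T (MonoidAlgebra.single x 1) = MonoidAlgebra.single (g * x * h) 1 := by
        simp [T, MonoidAlgebra.single_mul_single, mul_assoc]
      rw [this]
      change (MonoidAlgebra.single (g * x * h) (1 : ℂ)).coeff x = _
      rw [MonoidAlgebra.coeff_single, Finsupp.single_apply]
    rw [← h1, ← LinearMap.trace_conj' T e.toLinearEquiv]
    rw [LinearMap.trace_eq_matrix_trace ℂ
      (Pi.basis fun i ↦ Matrix.stdBasis ℂ (Fin (d i)) (Fin (d i))), Matrix.trace,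
      Fintype.sum_sigma]
    refine Finset.sum_congr rfl fun i _ ↦ ?_
    rw [Fintype.sum_prod_type]
    simp only [character, hρ, Matrix.trace_toLin'_eq]
    simp only [Matrix.trace, Finset.sum_mul_sum, Matrix.diag_apply]
    refine Finset.sum_congr rfl fun r _ ↦ Finset.sum_congr rfl fun s _ ↦ ?_
    rw [LinearMap.toMatrix_apply, Pi.basis_apply]
    simp only [Pi.basis_repr, LinearEquiv.conj_apply, LinearMap.comp_apply, T]
    simp [Matrix.stdBasis, Matrix.mul_apply, Pi.single_apply, ite_apply, ite_mul, mul_ite]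

theorem exists_irreducible_apply_ne_one {G : Type} [Group G] [Finite G] {g : G} (hg : g ≠ 1) :
    ∃ (V : Type) (_ : AddCommGroup V) (_ : Module ℂ V) (_ : FiniteDimensional ℂ V)
      (ρ : Representation ℂ G V), ρ.IsIrreducible ∧ ρ g ≠ 1 := by
  have := Fintype.ofFinite G
  obtain ⟨n, d, ρ, hirr, hsum⟩ := exists_irreducible_family G
  by_contra! hcon
  have h1 : ∀ i, ρ i g = 1 := fun i ↦ hcon _ _ _ inferInstance (ρ i) (hirr i)
  have h2 := hsum g 1
  have h3 := hsum 1 1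
  have h4 : ∀ i, (ρ i).character g = (ρ i).character 1 := fun i ↦ by
    rw [character, character, h1, (ρ i).map_one]
  simp only [h4] at h2
  rw [h3] at h2
  simp [hg] at h2

/-- If all elements of the coset `gE` of a nontrivial normal subgroup are conjugate to `g`, then
`g` is vanishing. -/
theorem IsVanishing.of_forall_isConj_mul {G : Type} [Group G] [Finite G] (E : Subgroup G)
    [E.Normal] (hE : E ≠ ⊥) (g : G) (hg : ∀ e ∈ E, IsConj (g * e) g) : IsVanishing G g := by
  obtain ⟨⟨e, he⟩, he1⟩ := Subgroup.ne_bot_iff_exists_ne_one.1 hE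
  have hne : e ≠ 1 := fun h ↦ he1 (Subtype.ext h)
  obtain ⟨V, _, _, _, ρ, hρ, h1⟩ := exists_irreducible_apply_ne_one hne
  refine IsVanishing.of_isIrreducible ρ hρ
    (character_eq_zero_of_forall_mul ρ hρ E ⟨e, he, h1⟩ g fun a ha ↦ ?_)
  obtain ⟨c, hc⟩ := isConj_iff.1 (hg a ha)
  have h2 := ρ.char_conj (g * a) c
  rw [hc] at h2
  exact h2.symm

/-- A representation of degree prime to `p` without `N`-fixed vectors has an irreducible
subrepresentation with the same properties. -/
theorem exists_irreducible_of_not_dvd_finrank (p : ℕ) (N : Subgroup G)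
    (hp : ¬ p ∣ Module.finrank ℂ V) (hN : ∀ v : V, (∀ x ∈ N, ρ x v = v) → v = 0) :
    ∃ (W : Type) (_ : AddCommGroup W) (_ : Module ℂ W) (_ : FiniteDimensional ℂ W)
      (σ : Representation ℂ G W), σ.IsIrreducible ∧ ¬ p ∣ Module.finrank ℂ W ∧
        (∀ v : W, (∀ x ∈ N, σ x v = v) → v = 0) ∧ ∀ g, ρ g = 1 → σ g = 1 := by
  induction hn : Module.finrank ℂ V using Nat.strong_induction_on generalizing V with
  | _ n ih =>
  subst hn
  by_cases h : ρ.IsIrreducible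
  · exact ⟨V, _, _, inferInstance, ρ, h, hp, hN, fun _ ↦ id⟩
  rw [isIrreducible_iff_forall_submodule] at h
  push Not at h
  have hnt : Nontrivial V := by
    by_contra hV
    rw [not_nontrivial_iff_subsingleton] at hV
    rw [Module.finrank_zero_of_subsingleton] at hp
    exact hp (dvd_zero p)
  obtain ⟨U, hU, hb, ht⟩ := h hnt
  obtain ⟨U', hU', hc⟩ := exists_isCompl_invariant ρ U hU
  have hadd := Submodule.finrank_add_eq_of_isCompl hc
  have key : ∀ U : Submodule ℂ V, (∀ g, ∀ v ∈ U, ρ g v ∈ U) → Module.finrank ℂ U <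
      Module.finrank ℂ V → ¬ p ∣ Module.finrank ℂ U → ∃ (W : Type) (_ : AddCommGroup W)
      (_ : Module ℂ W) (_ : FiniteDimensional ℂ W)
      (σ : Representation ℂ G W), σ.IsIrreducible ∧ ¬ p ∣ Module.finrank ℂ W ∧
        (∀ v : W, (∀ x ∈ N, σ x v = v) → v = 0) ∧ ∀ g, ρ g = 1 → σ g = 1 := by
    intro U hU hlt hpU
    let τ : Representation ℂ G U :=
      (⟨U, fun g v hv ↦ hU g v hv⟩ : Subrepresentation ρ).toRepresentation
    have hτ : ∀ g (v : U), (τ g v : V) = ρ g v := fun g v ↦ rfl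
    obtain ⟨W, i1, i2, i3, σ, h1, h2, h3, h4⟩ := ih _ hlt τ hpU (fun v hv ↦ by
      have := hN v fun x hx ↦ by rw [← hτ, hv x hx]
      simpa using this) rfl
    refine ⟨W, i1, i2, i3, σ, h1, h2, h3, fun g hg ↦ h4 g ?_⟩
    ext v
    rw [hτ, hg]; rfl
  by_cases hpU : p ∣ Module.finrank ℂ U
  · refine key U' hU' ?_ ?_
    · have : 0 < Module.finrank ℂ U := by
        rw [Nat.pos_iff_ne_zero]
        exact fun h ↦ hb (Submodule.finrank_eq_zero.1 h)
      omega
    · intro h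
      exact hp (hadd ▸ dvd_add hpU h)
  · exact key U hU (Submodule.finrank_lt ht) hpU

/-- If all vanishing elements have the same class size, it is the largest class size. -/
theorem classSize_le_of_forall_isVanishing {G : Type} [Group G] [Finite G] (c : ℕ)
    (h : ∀ g : G, IsVanishing G g → classSize g = c) (hex : ∃ g : G, IsVanishing G g) (g : G) :
    classSize g ≤ c := by
  have := Fintype.ofFinite G
  obtain ⟨n, d, ρ, hirr, hsum⟩ := exists_irreducible_family G
  have hcent : ∀ (g : G) (j : ℕ), j.Coprime (Nat.card G) →
      Subgroup.centralizer {g ^ j} = Subgroup.centralizer {g} := by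
    intro g j hj
    obtain ⟨m, hm⟩ := exists_pow_eq_self_of_coprime (x := g)
      (n := j) (hj.coprime_dvd_right (orderOf_dvd_natCard g))
    ext y
    simp only [Subgroup.mem_centralizer_singleton_iff]
    constructor
    · intro hy
      have h1 : Commute (g ^ j) y := hy.symm
      have h2 := h1.pow_left m
      rw [hm] at h2
      exact h2.symm
    · intro hy
      have h1 : Commute g y := hy.symm
      exact (h1.pow_left j).symm
  let Z : Finset G := Finset.univ.filter fun g ↦
    ∃ j : ℕ, j.Coprime (Nat.card G) ∧ IsVanishing G (g ^ j)
  have hZ : ∀ g ∈ Z, classSize g = c := by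
    intro g hg
    obtain ⟨j, hj, hv⟩ := (Finset.mem_filter.1 hg).2
    rw [← h _ hv, classSize, classSize, hcent g j hj]
  have hZne : ∃ g, g ∈ Z := hex.imp fun g hg ↦ Finset.mem_filter.2
    ⟨Finset.mem_univ _, 1, Nat.coprime_one_left _, by rwa [pow_one]⟩
  have hZc : ∀ g ∈ Zᶜ, ∀ j : ℕ, j.Coprime (Nat.card G) → g ^ j ∈ Zᶜ := by
    intro g hg j hj
    simp only [Z, Finset.mem_compl, Finset.mem_filter_univ] at hg ⊢
    rintro ⟨k, hk, hv⟩
    exact hg ⟨j * k, Nat.Coprime.mul_left hj hk, by rwa [pow_mul]⟩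
  have hZv : ∀ g ∈ Zᶜ, ∀ i, (ρ i).character g ≠ 0 := by
    intro g hg i h0
    simp only [Z, Finset.mem_compl, Finset.mem_filter_univ] at hg
    exact hg ⟨1, Nat.coprime_one_left _, by
      rw [pow_one]; exact IsVanishing.of_isIrreducible _ (hirr i) h0⟩
  have hcol : ∀ g : G, ∑ i, ‖(ρ i).character g‖ ^ 2 =
      (Nat.card (Subgroup.centralizer {g}) : ℝ) := by
    intro g
    have h1 := hsum g g⁻¹
    simp_rw [character_inv, Complex.mul_conj, Complex.normSq_eq_norm_sq] at h1
    have h2 : (Finset.univ.filter fun x ↦ g * x * g⁻¹ = x).card =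
        Nat.card (Subgroup.centralizer {g}) := by
      rw [← Fintype.card_subtype, Nat.card_eq_fintype_card]
      refine Fintype.card_congr (Equiv.subtypeEquivRight fun x ↦ ?_)
      rw [Subgroup.mem_centralizer_singleton_iff, mul_inv_eq_iff_eq_mul]
      exact eq_comm
    rw [h2] at h1
    exact_mod_cast h1
  have hcardC : ∀ g : G, Nat.card (Subgroup.centralizer {g}) * classSize g = Nat.card G :=
    fun g ↦ Subgroup.card_mul_index _
  have hrow : ∀ i, ∑ g ∈ Z, ‖(ρ i).character g‖ ^ 2 ≤ (Z.card : ℝ) := by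
    intro i
    have h1 := card_le_sum_norm_sq_character (ρ i) Zᶜ hZc (fun g hg ↦ hZv g hg i)
    have h2 := sum_norm_sq_character (ρ i) (hirr i)
    rw [← Finset.sum_add_sum_compl Z] at h2
    rw [Finset.card_compl, Nat.cast_sub (Finset.card_le_univ _), ← Nat.card_eq_fintype_card] at h1
    linarith
  have hup : ∀ g ∈ Z, Nat.card (Subgroup.centralizer {g}) ≤ n := by
    intro g hg
    have h1 : ∑ x ∈ Z, (Nat.card (Subgroup.centralizer {x}) : ℝ) ≤ n * Z.card := by
      simp_rw [← hcol]
      rw [Finset.sum_comm]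
      refine (Finset.sum_le_sum fun i _ ↦ hrow i).trans ?_
      simp
    have hcpos : 0 < c := by
      rw [← hZ g hg]
      exact Nat.pos_of_mul_pos_left (hcardC g ▸ Nat.card_pos)
    have h2 : ∀ x ∈ Z, (Nat.card (Subgroup.centralizer {x}) : ℝ) =
        Nat.card (Subgroup.centralizer {g}) := by
      intro x hx
      have h3 := hcardC x
      rw [← hcardC g, hZ x hx, hZ g hg] at h3
      exact_mod_cast Nat.eq_of_mul_eq_mul_right hcpos h3
    rw [Finset.sum_congr rfl h2, Finset.sum_const, nsmul_eq_mul, mul_comm] at h1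
    have h4 : (0 : ℝ) < Z.card := by exact_mod_cast Finset.card_pos.2 ⟨g, hg⟩
    exact_mod_cast le_of_mul_le_mul_right h1 h4
  by_cases hg : g ∈ Z
  · exact (hZ g hg).le
  have hlow : n ≤ Nat.card (Subgroup.centralizer {g}) := by
    obtain ⟨K, _, _, j, τ, -, hj, hx⟩ := exists_galois_data G
    choose x hx1 hx2 using fun i ↦ hx _ (ρ i) g
    have : Nonempty (K →ₐ[ℚ] ℂ) := ⟨τ⟩
    have hgc : g ∈ Zᶜ := Finset.mem_compl.2 hg
    have h1 := card_le_of_forall_le_sum Finset.univ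
      (fun i (σ : K →ₐ[ℚ] ℂ) ↦ ‖σ (x i)‖ ^ 2) (Nat.card (Subgroup.centralizer {g}))
      (fun i _ ↦ card_embeddings_le_sum_norm_sq (hx1 i) fun h0 ↦ by
        apply hZv _ (hZc g hgc (j τ) (hj τ)) i
        rw [← hx2, h0, map_zero])
      (fun σ ↦ by
        simp_rw [hx2]
        rw [hcol, hcent g _ (hj σ)])
    simpa using h1
  obtain ⟨z, hz⟩ := hZne
  have h1 := hcardC z
  have h2 := hcardC g
  rw [hZ z hz] at h1
  have h3 := hup z hz
  by_contra! hlt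
  have h4 : 0 < Nat.card (Subgroup.centralizer {g}) := Nat.card_pos
  have h5 : Nat.card (Subgroup.centralizer {z}) ≤ Nat.card (Subgroup.centralizer {g}) :=
    h3.trans hlow
  nlinarith

end

end

theorem exists_mul_eq_of_coprime_index {G : Type*} [Group G] [Finite G] (H K : Subgroup G)
    (h : H.index.Coprime K.index) (g : G) : ∃ a ∈ H, ∃ b ∈ K, g = a * b := by
  have h1 : K.relIndex H * H.index = (K ⊓ H).index := by
    rw [← Subgroup.inf_relIndex_right, Subgroup.relIndex_mul_index inf_le_right]
  have h2 : K.index ∣ K.relIndex H := by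
    refine h.symm.dvd_of_dvd_mul_right ?_
    rw [h1]
    exact Subgroup.index_dvd_of_le inf_le_left
  have h0 (a : H) : a • ((1 : G) : G ⧸ K) = ((a : G) : G ⧸ K) :=
    congrArg (QuotientGroup.mk : G → G ⧸ K) (mul_one (a : G))
  have h3 : MulAction.stabilizer H ((1 : G) : G ⧸ K) = K.subgroupOf H := by
    ext a
    rw [MulAction.mem_stabilizer_iff, Subgroup.mem_subgroupOf, h0, QuotientGroup.eq]
    simp
  have h4 := MulAction.index_stabilizer H ((1 : G) : G ⧸ K)
  rw [h3] at h4
  have h5 : MulAction.orbit H ((1 : G) : G ⧸ K) = Set.univ := by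
    refine Set.eq_of_subset_of_ncard_le (Set.subset_univ _) ?_
    rw [Set.ncard_univ, ← h4]
    have h6 := Nat.le_of_dvd (Nat.pos_of_ne_zero Subgroup.index_ne_zero_of_finite) h2
    rwa [Subgroup.index_eq_card K] at h6
  obtain ⟨a, ha⟩ : (g : G ⧸ K) ∈ MulAction.orbit H ((1 : G) : G ⧸ K) := h5 ▸ Set.mem_univ _
  refine ⟨a, a.2, (a : G)⁻¹ * g, ?_, by group⟩
  rw [← QuotientGroup.eq, ← ha]
  exact (h0 a).symm

theorem mem_centralizer_singleton_iff_commute {G : Type*} [Group G] {g y : G} :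
    y ∈ Subgroup.centralizer {g} ↔ Commute y g := by
  rw [Subgroup.mem_centralizer_singleton_iff]
  exact Iff.rfl

section

variable {G : Type*} [Group G] [Finite G]

omit [Finite G] in
theorem classSize_map_dvd {K : Type*} [Group K] (f : G →* K) (hf : Function.Surjective f) (g : G) :
    classSize (f g) ∣ classSize g := by
  refine (Subgroup.index_dvd_of_le ?_).trans (Subgroup.index_map_dvd _ hf)
  rintro _ ⟨y, hy, rfl⟩
  rw [SetLike.mem_coe, mem_centralizer_singleton_iff_commute] at hy
  rw [mem_centralizer_singleton_iff_commute]
  exact hy.map f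

theorem relIndex_eq_relIndex_sup (C N : Subgroup G) [N.Normal] :
    C.relIndex N = C.relIndex (C ⊔ N) := by
  have h3 : C.relIndex N * N.relIndex (C ⊔ N) = N.relIndex C * C.relIndex (C ⊔ N) := by
    rw [← Subgroup.inf_relIndex_right C N, ← Subgroup.inf_relIndex_left C N,
      Subgroup.relIndex_mul_relIndex _ _ _ inf_le_right le_sup_right,
      Subgroup.relIndex_mul_relIndex _ _ _ inf_le_left le_sup_left]
  rw [Subgroup.relIndex_sup_right, mul_comm] at h3
  exact Nat.eq_of_mul_eq_mul_left (Nat.pos_of_ne_zero Subgroup.index_ne_zero_of_finite) h3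

omit [Finite G] in
theorem classSize_subtype (N : Subgroup G) (x : N) :
    classSize x = (Subgroup.centralizer {(x : G)}).relIndex N := by
  have h1 : Subgroup.centralizer {x} = (Subgroup.centralizer {(x : G)}).subgroupOf N := by
    ext y
    rw [Subgroup.mem_subgroupOf, mem_centralizer_singleton_iff_commute,
      mem_centralizer_singleton_iff_commute]
    exact ⟨fun h ↦ h.map N.subtype, fun h ↦ Subtype.ext h⟩
  rw [classSize, h1]
  rfl

theorem classSize_subtype_dvd (N : Subgroup G) [N.Normal] (x : N) :
    classSize x ∣ classSize (x : G) := by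
  rw [classSize_subtype, relIndex_eq_relIndex_sup]
  exact Subgroup.relIndex_dvd_index_of_le le_sup_left

theorem relIndex_eq_classSize (N : Subgroup G) [N.Normal] {x : G}
    (h : ∀ g : G, ∃ u ∈ N, ∃ c, Commute c x ∧ g = u * c) :
    (Subgroup.centralizer {x}).relIndex N = classSize x := by
  rw [relIndex_eq_relIndex_sup]
  have : Subgroup.centralizer {x} ⊔ N = ⊤ := by
    rw [eq_top_iff]
    rintro g -
    obtain ⟨u, hu, c, hc, rfl⟩ := h g
    exact mul_mem (Subgroup.mem_sup_right hu)
      (Subgroup.mem_sup_left (mem_centralizer_singleton_iff_commute.2 hc))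
  rw [this, Subgroup.relIndex_top_right]
  rfl

omit [Finite G] in
theorem exists_mul_eq_of_sup_eq_top {N H : Subgroup G} [N.Normal] (h : N ⊔ H = ⊤) (g : G) :
    ∃ u ∈ N, ∃ k ∈ H, g = u * k := by
  have hg : g ∈ ((N ⊔ H : Subgroup G) : Set G) := by rw [h]; trivial
  rw [Subgroup.normal_mul] at hg
  obtain ⟨u, hu, k, hk, h⟩ := hg
  exact ⟨u, hu, k, hk, h.symm⟩

omit [Finite G] in
theorem classSize_mul_mem_center (g : G) {z : G} (hz : z ∈ Subgroup.center G) :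
    classSize (g * z) = classSize g := by
  have h : Subgroup.centralizer {g * z} = Subgroup.centralizer {g} := by
    ext y
    rw [mem_centralizer_singleton_iff_commute, mem_centralizer_singleton_iff_commute]
    have hy : Commute y z := Subgroup.mem_center_iff.1 hz y
    refine ⟨fun h ↦ ?_, fun h ↦ h.mul_right hy⟩
    have := h.mul_right hy.inv_right
    rwa [mul_inv_cancel_right] at this
  rw [classSize, h]
  rfl

omit [Finite G] in
theorem classSize_eq_one_iff {g : G} : classSize g = 1 ↔ g ∈ Subgroup.center G := by
  rw [classSize, Subgroup.index_eq_one, Subgroup.mem_center_iff, Subgroup.eq_top_iff']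
  exact forall_congr' fun y ↦ mem_centralizer_singleton_iff_commute

omit [Finite G] in
theorem classSize_eq_of_isConj {g h : G} (H : IsConj g h) : classSize g = classSize h := by
  rw [classSize_eq_ncard, classSize_eq_ncard]
  congr 1
  ext y
  exact ⟨fun h1 ↦ H.symm.trans h1, fun h1 ↦ H.trans h1⟩

omit [Finite G] in
theorem mem_zpowers_mul_of_coprime {x y : G} (hxy : Commute x y)
    (hc : (orderOf x).Coprime (orderOf y)) : ∃ e : ℕ, (x * y) ^ e = x := by
  obtain ⟨e, he1, he2⟩ := Nat.chineseRemainder hc 1 0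
  refine ⟨e, ?_⟩
  rw [hxy.mul_pow]
  have h1 : x ^ e = x := by
    conv_rhs => rw [← pow_one x]
    exact pow_eq_pow_iff_modEq.2 he1
  have h2 : y ^ e = 1 := by
    rw [← pow_zero y]
    exact pow_eq_pow_iff_modEq.2 he2
  rw [h1, h2, mul_one]

omit [Finite G] in
theorem centralizer_mul_le_left {x y : G} (hxy : Commute x y)
    (hc : (orderOf x).Coprime (orderOf y)) :
    Subgroup.centralizer {x * y} ≤ Subgroup.centralizer {x} := by
  obtain ⟨e, he⟩ := mem_zpowers_mul_of_coprime hxy hc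
  intro c h
  rw [mem_centralizer_singleton_iff_commute] at h ⊢
  rw [← he]
  exact h.pow_right e

omit [Finite G] in
theorem centralizer_mul_le_right {x y : G} (hxy : Commute x y)
    (hc : (orderOf x).Coprime (orderOf y)) :
    Subgroup.centralizer {x * y} ≤ Subgroup.centralizer {y} := by
  rw [hxy.eq]
  exact centralizer_mul_le_left hxy.symm hc.symm

theorem centralizer_le_of_classSize_mul_le {x y : G} (hxy : Commute x y)
    (hc : (orderOf x).Coprime (orderOf y)) (h : classSize (x * y) ≤ classSize x) :
    Subgroup.centralizer {x} ≤ Subgroup.centralizer {y} := by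
  have h1 := centralizer_mul_le_left hxy hc
  have h2 : Subgroup.centralizer {x * y} = Subgroup.centralizer {x} := by
    by_contra hne
    exact absurd h (not_le.2 (Subgroup.index_strictAnti (lt_of_le_of_ne h1 hne)))
  rw [← h2]
  exact centralizer_mul_le_right hxy hc

/-- The decomposition of `g` into its `p`-part and its `p'`-part. -/
theorem exists_pow_mul_pow_eq (p : ℕ) (hp : p.Prime) (g : G) : ∃ a b : ℕ, g ^ a * g ^ b = g ∧
    (∃ k, (g ^ a) ^ p ^ k = 1) ∧ p.Coprime (orderOf (g ^ b)) := by
  obtain ⟨k, m, hm, hg⟩ := Nat.exists_eq_pow_mul_and_not_dvd (orderOf_pos g).ne' p hp.ne_one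
  have hc : (p ^ k).Coprime m := Nat.Coprime.pow_left _ ((Nat.Prime.coprime_iff_not_dvd hp).2 hm)
  obtain ⟨a, ha1, ha2⟩ := Nat.chineseRemainder hc 1 0
  obtain ⟨b, hb1, hb2⟩ := Nat.chineseRemainder hc 0 1
  refine ⟨a, b, ?_, ⟨k, ?_⟩, ?_⟩
  · rw [← pow_add]
    conv_rhs => rw [← pow_one g]
    rw [pow_eq_pow_iff_modEq, hg]
    exact (Nat.modEq_and_modEq_iff_modEq_mul hc).1 ⟨ha1.add hb1, by simpa using ha2.add hb2⟩
  · rw [← pow_mul, ← orderOf_dvd_iff_pow_eq_one, hg, mul_comm a]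
    exact mul_dvd_mul_left _ ((Nat.modEq_zero_iff_dvd).1 ha2)
  · have : orderOf (g ^ b) ∣ m := by
      rw [orderOf_dvd_iff_pow_eq_one, ← pow_mul, ← orderOf_dvd_iff_pow_eq_one, hg]
      exact mul_dvd_mul_right ((Nat.modEq_zero_iff_dvd).1 hb1) _
    exact ((Nat.Prime.coprime_iff_not_dvd hp).2 hm).coprime_dvd_right this

end

/-- If no nontrivial element of the normal subgroup `K` commutes with `a`, then every element of
`Ka` is conjugate to `a` under `K`. -/
theorem exists_mul_eq_conj {G : Type*} [Group G] [Finite G] (K : Subgroup G) [hK : K.Normal] (a : G)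
    (h : ∀ k ∈ K, Commute k a → k = 1) {u : G} (hu : u ∈ K) :
    ∃ k ∈ K, u * a = k * a * k⁻¹ := by
  let f : K → K := fun k ↦ ⟨k * (a * (k : G)⁻¹ * a⁻¹),
    mul_mem k.2 (hK.conj_mem _ (inv_mem k.2) a)⟩
  have hf : Function.Injective f := by
    intro k l hkl
    have h1 : (k : G) * (a * (k : G)⁻¹ * a⁻¹) = l * (a * (l : G)⁻¹ * a⁻¹) :=
      congrArg Subtype.val hkl
    have h2 : (l : G)⁻¹ * k = 1 := by
      refine h _ (mul_mem (inv_mem l.2) k.2) ?_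
      calc (l : G)⁻¹ * k * a = (l : G)⁻¹ * (k * (a * (k : G)⁻¹ * a⁻¹)) * a * k := by group
        _ = a * ((l : G)⁻¹ * k) := by rw [h1]; group
    exact Subtype.ext (inv_mul_eq_one.1 h2).symm
  obtain ⟨k, hk⟩ := (Finite.injective_iff_surjective.1 hf) ⟨u, hu⟩
  refine ⟨k, k.2, ?_⟩
  have h1 : (k : G) * (a * (k : G)⁻¹ * a⁻¹) = u := congrArg Subtype.val hk
  rw [← h1]
  group

/-- A noncentral element of a normal `p`-subgroup `P` whose centralizer supplements `P` is
vanishing. -/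
theorem IsVanishing.of_mem_isPGroup {p : ℕ} (hp : p.Prime) {G : Type} [Group G] [Finite G]
    (P : Subgroup G) [P.Normal] (hP : IsPGroup p P) {x : G} (hx : x ∈ P)
    (hnc : ∃ u ∈ P, ¬ Commute u x)
    (hG : ∀ g : G, ∃ u ∈ P, ∃ c, Commute c x ∧ g = u * c) : IsVanishing G x := by
  induction hn : Nat.card G using Nat.strong_induction_on generalizing G with
  | _ n ih =>
  subst hn
  have : Fact p.Prime := ⟨hp⟩
  let Z : Subgroup G := (Subgroup.center P).map P.subtype
  have hmem : ∀ z, z ∈ Z ↔ z ∈ P ∧ ∀ u ∈ P, u * z = z * u := by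
    intro z
    constructor
    · rintro ⟨w, hw, rfl⟩
      refine ⟨w.2, fun u hu ↦ ?_⟩
      exact congrArg Subtype.val (Subgroup.mem_center_iff.1 hw ⟨u, hu⟩)
    · rintro ⟨h1, h2⟩
      exact ⟨⟨z, h1⟩, Subgroup.mem_center_iff.2 fun u ↦ Subtype.ext (h2 u u.2), rfl⟩
  by_cases hcase : ∃ u ∈ P, x⁻¹ * u * x * u⁻¹ ∉ Z
  · refine IsVanishing.of_surjective (QuotientGroup.mk' Z) (QuotientGroup.mk'_surjective Z) ?_
    have hcard : Nat.card (G ⧸ Z) < Nat.card G := by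
      have hZ : Z ≠ ⊥ := by
        obtain ⟨u, hu, hux⟩ := hnc
        have : Nontrivial P := by
          refine ⟨⟨⟨u, hu⟩, 1, fun h ↦ hux ?_⟩⟩
          have : u = 1 := congrArg Subtype.val h
          rw [this]
          exact Commute.one_left x
        have h1 := hP.bot_lt_center
        intro h2
        rw [Subgroup.map_eq_bot_iff_of_injective _ P.subtype_injective] at h2
        exact h1.ne' h2
      have h1 := Z.card_mul_index
      have h2 : 1 < Nat.card Z := Subgroup.one_lt_card_iff_ne_bot _ |>.2 hZ
      rw [← Subgroup.index_eq_card, ← h1]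
      have h3 : 0 < Z.index := Nat.pos_of_ne_zero Subgroup.index_ne_zero_of_finite
      nlinarith
    have hN : (P.map (QuotientGroup.mk' Z)).Normal :=
      Subgroup.Normal.map inferInstance _ (QuotientGroup.mk'_surjective Z)
    refine ih _ hcard (P.map (QuotientGroup.mk' Z)) (hP.map _) ⟨x, hx, rfl⟩ ?_ ?_ rfl
    · obtain ⟨u, hu, hux⟩ := hcase
      refine ⟨_, ⟨u, hu, rfl⟩, fun h ↦ hux ?_⟩
      rw [← QuotientGroup.eq_one_iff]
      have h' : (u : G ⧸ Z) * x = x * u := h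
      simp only [QuotientGroup.mk_mul, QuotientGroup.mk_inv]
      rw [mul_assoc (_⁻¹), h']
      group
    · intro g
      obtain ⟨g, rfl⟩ := QuotientGroup.mk'_surjective Z g
      obtain ⟨u, hu, c, hc, rfl⟩ := hG g
      exact ⟨_, ⟨u, hu, rfl⟩, _, hc.map _, map_mul _ _ _⟩
  push Not at hcase
  let E : Subgroup G :=
    { carrier := {e | ∃ u ∈ P, x⁻¹ * u * x * u⁻¹ = e}
      one_mem' := ⟨1, P.one_mem, by group⟩
      mul_mem' := by
        rintro _ _ ⟨u, hu, rfl⟩ ⟨v, hv, rfl⟩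
        refine ⟨u * v, P.mul_mem hu hv, ?_⟩
        have h1 := ((hmem _).1 (hcase v hv)).2 u hu
        calc x⁻¹ * (u * v) * x * (u * v)⁻¹
            = x⁻¹ * u * x * (x⁻¹ * v * x * v⁻¹) * u⁻¹ := by group
          _ = x⁻¹ * u * x * (u⁻¹ * (u * (x⁻¹ * v * x * v⁻¹))) * u⁻¹ := by group
          _ = _ := by rw [h1]; group
      inv_mem' := by
        rintro _ ⟨u, hu, rfl⟩
        refine ⟨u⁻¹, P.inv_mem hu, ?_⟩
        have h1 := ((hmem _).1 (hcase _ (P.inv_mem hu))).2 u hu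
        calc x⁻¹ * u⁻¹ * x * u⁻¹⁻¹ = x⁻¹ * u⁻¹ * x * u⁻¹⁻¹ * u * u⁻¹ := by group
          _ = _ := by rw [← h1]; group }
  have hEn : E.Normal := by
    constructor
    rintro _ ⟨u, hu, rfl⟩ g
    obtain ⟨w, hw, c, hc, rfl⟩ := hG g
    have hcP : c * u * c⁻¹ ∈ P := Subgroup.Normal.conj_mem inferInstance u hu c
    refine ⟨c * u * c⁻¹, hcP, ?_⟩
    have h1 := ((hmem _).1 (hcase _ hcP)).2 w hw
    have h2 : x⁻¹ * (c * u * c⁻¹) * x * (c * u * c⁻¹)⁻¹ = c * (x⁻¹ * u * x * u⁻¹) * c⁻¹ := by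
      have h3 : c⁻¹ * x = x * c⁻¹ := (hc.inv_left).eq
      have h4 : x⁻¹ * c = c * x⁻¹ := (hc.inv_right).eq.symm
      calc x⁻¹ * (c * u * c⁻¹) * x * (c * u * c⁻¹)⁻¹
          = (x⁻¹ * c) * u * (c⁻¹ * x) * c * u⁻¹ * c⁻¹ := by group
        _ = _ := by rw [h3, h4]; group
    rw [h2] at h1 ⊢
    calc c * (x⁻¹ * u * x * u⁻¹) * c⁻¹
        = (c * (x⁻¹ * u * x * u⁻¹) * c⁻¹) * w * w⁻¹ := by group
      _ = _ := by rw [← h1]; group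
  refine IsVanishing.of_forall_isConj_mul E ?_ x ?_
  · obtain ⟨u, hu, hux⟩ := hnc
    intro h
    apply hux
    have h1 : x⁻¹ * u * x * u⁻¹ ∈ E := ⟨u, hu, rfl⟩
    rw [h, Subgroup.mem_bot] at h1
    have h2 : x⁻¹ * (u * x) = u := by
      rw [← mul_assoc]
      exact mul_inv_eq_one.1 h1
    exact inv_mul_eq_iff_eq_mul.1 h2
  · rintro _ ⟨u, hu, rfl⟩
    refine isConj_iff.2 ⟨u⁻¹, ?_⟩
    group

theorem vcs_eq_of_isPGroup_of_commute (G : Type) [Group G] [Finite G] {p : ℕ} (hp : p.Prime)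
    {α : ℕ} (hα : 0 < α) (P H : Subgroup G) [P.Normal] (hP : IsPGroup p P)
    (hH : IsAbelianSubgroup H) (hPH : P ⊔ H = ⊤) (hc : ∀ h ∈ H, ∀ x ∈ P, Commute h x)
    (hcs : cs P = {1, p ^ α}) : vcs G = {p ^ α} := by
  have hpa : p ^ α ≠ 1 := (Nat.one_lt_pow hα.ne' hp.one_lt).ne'
  have hHc : H ≤ Subgroup.center G := by
    intro h hh
    rw [Subgroup.mem_center_iff]
    intro g
    obtain ⟨u, hu, k, hk, rfl⟩ := exists_mul_eq_of_sup_eq_top hPH g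
    exact ((hc h hh u hu).symm.mul_left (hH k hk h hh)).eq
  have hsz : ∀ x : P, classSize (x : G) = classSize x := by
    intro x
    rw [classSize_subtype, relIndex_eq_classSize]
    intro g
    obtain ⟨u, hu, k, hk, rfl⟩ := exists_mul_eq_of_sup_eq_top hPH g
    exact ⟨u, hu, k, hc k hk x x.2, rfl⟩
  have hval : ∀ x : P, ¬ (x : G) ∈ Subgroup.center G → classSize (x : G) = p ^ α := by
    intro x hx
    have h1 : classSize x ∈ cs P := ⟨x, rfl⟩
    rw [hcs] at h1
    rw [hsz]
    rcases h1 with h1 | h1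
    · rw [← hsz, classSize_eq_one_iff] at h1
      exact absurd h1 hx
    · exact h1
  ext n
  constructor
  · rintro ⟨g, hg, rfl⟩
    obtain ⟨u, hu, k, hk, rfl⟩ := exists_mul_eq_of_sup_eq_top hPH g
    have hu' : IsVanishing G u := by
      have := hg.mul_mem_center (Subgroup.inv_mem _ (hHc hk))
      rwa [mul_inv_cancel_right] at this
    rw [classSize_mul_mem_center _ (hHc hk)]
    exact hval ⟨u, hu⟩ fun h ↦ not_isVanishing_of_mem_center h hu'
  · rintro rfl
    have h1 : p ^ α ∈ cs P := by rw [hcs]; exact Or.inr rfl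
    obtain ⟨x, hx⟩ := h1
    refine ⟨x, ?_, by rw [hsz, hx]⟩
    refine IsVanishing.of_mem_isPGroup hp P hP x.2 ?_ ?_
    · by_contra! hcon
      have : x ∈ Subgroup.center P :=
        Subgroup.mem_center_iff.2 fun y ↦ Subtype.ext (hcon y y.2).eq
      rw [classSize_eq_one_iff.2 this] at hx
      exact hpa hx.symm
    · intro g
      obtain ⟨u, hu, k, hk, rfl⟩ := exists_mul_eq_of_sup_eq_top hPH g
      exact ⟨u, hu, k, hc k hk x x.2, rfl⟩

theorem vcs_eq_of_isFrobenius (G : Type) [Group G] [Finite G] {n : ℕ}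
    (P H : Subgroup G) [P.Normal] (hH : IsAbelianSubgroup H) (hPH : P ⊔ H = ⊤)
    (hF : IsFrobenius (P.map (QuotientGroup.mk' (Subgroup.center G)))
      (H.map (QuotientGroup.mk' (Subgroup.center G))))
    (hcard : Nat.card (P.map (QuotientGroup.mk' (Subgroup.center G))) = n)
    (hnv : ∀ x ∈ P, ¬ IsVanishing G x) : vcs G = {n} := by
  set π := QuotientGroup.mk' (Subgroup.center G) with hπ
  have hsurj : Function.Surjective π := QuotientGroup.mk'_surjective _
  have hker : ∀ z, π z = 1 ↔ z ∈ Subgroup.center G := fun z ↦ QuotientGroup.eq_one_iff z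
  set K := P.map π with hK
  obtain ⟨⟨hKbot, hKtop, hKn, hKc⟩, -, -⟩ := hF
  have hcen : ∀ a, a ∉ K → ∀ k ∈ K, Commute k a → k = 1 := by
    intro a ha k hk hka
    by_contra hk1
    exact ha (hKc k hk hk1 (mem_centralizer_singleton_iff_commute.2 hka.symm))
  have hconj : ∀ a, a ∉ K → ∀ u ∈ K, ∃ k ∈ K, u * a = k * a * k⁻¹ := by
    intro a ha u hu
    exact exists_mul_eq_conj K a (hcen a ha) hu
  have hsize : ∀ h ∈ H, π h ∉ K → classSize h = n := by
    intro h hh hhK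
    rw [← relIndex_eq_classSize P, ← hcard, hK, ← Subgroup.relIndex_ker,
      ← Subgroup.inf_relIndex_right, ← Subgroup.inf_relIndex_right π.ker]
    · congr 1
      ext x
      simp only [Subgroup.mem_inf, mem_centralizer_singleton_iff_commute, MonoidHom.mem_ker]
      constructor
      · rintro ⟨h1, h2⟩
        exact ⟨hcen _ hhK _ ⟨x, h2, rfl⟩ (h1.map π), h2⟩
      · rintro ⟨h1, h2⟩
        exact ⟨(Subgroup.mem_center_iff.1 ((hker x).1 h1) h).symm, h2⟩
    · intro g
      obtain ⟨u, hu, k, hk, rfl⟩ := exists_mul_eq_of_sup_eq_top hPH g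
      exact ⟨u, hu, k, hH k hk h hh, rfl⟩
  ext m
  constructor
  · rintro ⟨g, hg, rfl⟩
    obtain ⟨u, hu, h, hh, rfl⟩ := exists_mul_eq_of_sup_eq_top hPH g
    have hhK : π h ∉ K := by
      rintro ⟨v, hv, hvh⟩
      have h1 : v⁻¹ * h ∈ Subgroup.center G := by
        rw [← hker, map_mul, map_inv, hvh, inv_mul_cancel]
      apply hnv _ (mul_mem hu hv)
      have h2 := hg.mul_mem_center (inv_mem h1)
      rwa [mul_inv_rev, inv_inv, mul_assoc, ← mul_assoc h, mul_inv_cancel, one_mul] at h2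
    obtain ⟨k, ⟨v, hv, rfl⟩, hk⟩ := hconj _ hhK (π u) ⟨u, hu, rfl⟩
    have h1 : h⁻¹ * (v⁻¹ * (u * h) * v) ∈ Subgroup.center G := by
      rw [← hker]
      simp only [map_mul, map_inv]
      rw [hk]
      group
    have h2 : IsConj (u * h) (h * (h⁻¹ * (v⁻¹ * (u * h) * v))) :=
      isConj_iff.2 ⟨v⁻¹, by group⟩
    rw [classSize_eq_of_isConj h2, classSize_mul_mem_center _ h1]
    exact hsize h hh hhK
  · rintro rfl
    obtain ⟨g, hg⟩ : ∃ g, π g ∉ K := by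
      by_contra! hcon
      exact hKtop (eq_top_iff.2 fun x _ ↦ by obtain ⟨g, rfl⟩ := hsurj x; exact hcon g)
    obtain ⟨u, hu, h, hh, rfl⟩ := exists_mul_eq_of_sup_eq_top hPH g
    have hhK : π h ∉ K := fun h1 ↦ hg (by rw [map_mul]; exact mul_mem ⟨u, hu, rfl⟩ h1)
    refine ⟨h, IsVanishing.of_surjective π hsurj ?_, hsize h hh hhK⟩
    refine IsVanishing.of_forall_isConj_mul K hKbot _ fun e he ↦ ?_
    obtain ⟨k, hk, h1⟩ := hconj _ hhK _ (hKn.conj_mem e he (π h))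
    rw [inv_mul_cancel_right] at h1
    rw [h1]
    exact isConj_iff.2 ⟨k⁻¹, by group⟩

/-- A nontrivial normal `p`-subgroup `E` contains a nontrivial element centralised by a given
`p`-subgroup `P`. -/
theorem exists_ne_one_forall_commute {p : ℕ} [Fact p.Prime] {G : Type*} [Group G] [Finite G]
    (P E : Subgroup G) [E.Normal] (hP : IsPGroup p P) (hE : IsPGroup p E) (h : E ≠ ⊥) :
    ∃ e ∈ E, e ≠ 1 ∧ ∀ u ∈ P, Commute u e := by
  let _ : MulAction P E := MulAction.compHom E ((MulAut.conjNormal (H := E)).comp P.subtype)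
  have hs : ∀ (u : P) (e : E), ((u • e : E) : G) = u * e * (u : G)⁻¹ := fun u e ↦ rfl
  have h1 : p ∣ Nat.card E := by
    rcases hE.card_eq_or_dvd with h1 | h1
    · exact absurd (Subgroup.card_eq_one.1 h1) h
    · exact h1
  have h2 : (1 : E) ∈ MulAction.fixedPoints P E := by
    intro u
    apply Subtype.ext
    rw [hs]
    simp
  obtain ⟨e, he, hne⟩ := hP.exists_fixed_point_of_prime_dvd_card_of_fixed_point E h1 h2
  refine ⟨e, e.2, fun h3 ↦ hne (Subtype.ext h3.symm), fun u hu ↦ ?_⟩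
  have h4 := congrArg Subtype.val (he ⟨u, hu⟩)
  rw [hs] at h4
  exact mul_inv_eq_iff_eq_mul.1 h4

theorem eq_one_of_pow_eq_one_of_coprime {G : Type*} [Group G] {f : G} {m n : ℕ}
    (h : m.Coprime n) (hm : f ^ m = 1) (hn : f ^ n = 1) : f = 1 := by
  rw [← orderOf_eq_one_iff]
  exact Nat.eq_one_of_dvd_coprimes h (orderOf_dvd_of_pow_eq_one hm) (orderOf_dvd_of_pow_eq_one hn)

theorem pow_conj_eq_mul_pow {G : Type*} [Group G] {y e f : G}
    (h : y * e * y⁻¹ = e * f) (hf : Commute y f) (n : ℕ) :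
    y ^ n * e * (y ^ n)⁻¹ = e * f ^ n := by
  induction n with
  | zero => simp
  | succ n ih =>
    have h1 : y * f ^ n * y⁻¹ = f ^ n := by
      rw [(hf.pow_right n).eq, mul_inv_cancel_right]
    calc y ^ (n + 1) * e * (y ^ (n + 1))⁻¹ = y * (y ^ n * e * (y ^ n)⁻¹) * y⁻¹ := by
          rw [pow_succ']; group
      _ = (y * e * y⁻¹) * (y * f ^ n * y⁻¹) := by rw [ih]; group
      _ = e * f ^ (n + 1) := by rw [h, h1, pow_succ', mul_assoc]

theorem eq_one_of_conj_eq_mul {p : ℕ} {G : Type*} [Group G] {y e f : G}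
    (hy : p.Coprime (orderOf y)) (h : y * e * y⁻¹ = e * f) (hf : Commute y f)
    (hfp : ∃ k, f ^ p ^ k = 1) : f = 1 := by
  obtain ⟨k, hk⟩ := hfp
  have h2 := pow_conj_eq_mul_pow h hf (orderOf y)
  rw [pow_orderOf_eq_one] at h2
  have h3 : f ^ orderOf y = 1 := by simpa using h2
  exact eq_one_of_pow_eq_one_of_coprime (hy.pow_left k) hk h3

theorem mem_of_pow_mem_of_coprime {p : ℕ} {G : Type*} [Group G] {s : G}
    (hs : p.Coprime (orderOf s)) (Z : Subgroup G) {j : ℕ} (h : s ^ p ^ j ∈ Z) : s ∈ Z := by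
  obtain ⟨m, hm⟩ := exists_pow_eq_self_of_coprime (x := s) (hs.pow_left j)
  rw [← hm]
  exact pow_mem h m

section

variable {p : ℕ} [hp : Fact p.Prime] {G : Type} [Group G] [Finite G] (P : Subgroup G) [P.Normal]
  (hP : IsPGroup p P)

omit [Finite G] hp in
theorem IsPGroup.exists_pow_eq_one {P : Subgroup G} (hP : IsPGroup p P) {x : G} (hx : x ∈ P) :
    ∃ k, x ^ p ^ k = 1 := by
  obtain ⟨k, hk⟩ := isPGroup_iff_pow_pow_eq_one.1 hP ⟨x, hx⟩
  exact ⟨k, congrArg Subtype.val hk⟩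

omit [Finite G] in
theorem mem_of_pow_eq_one_of_not_dvd_index (hi : ¬ p ∣ P.index) {u : G}
    (hu : ∃ k, u ^ p ^ k = 1) : u ∈ P := by
  obtain ⟨k, hk⟩ := hu
  rw [← QuotientGroup.eq_one_iff]
  refine eq_one_of_pow_eq_one_of_coprime (m := p ^ k) (n := P.index)
    (Nat.Coprime.pow_left _ ((Nat.Prime.coprime_iff_not_dvd hp.out).2 hi)) ?_ ?_
  · rw [← QuotientGroup.mk_pow, hk, QuotientGroup.mk_one]
  · rw [Subgroup.index_eq_card]
    exact pow_card_eq_one'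

include hP

omit hp [Finite G] in
theorem mem_center_of_forall_commute (hab : ∀ a b : G, a * b * a⁻¹ * b⁻¹ ∈ P) {s : G}
    (hs : p.Coprime (orderOf s)) (h : ∀ x ∈ P, Commute s x) : s ∈ Subgroup.center G := by
  rw [Subgroup.mem_center_iff]
  intro g
  have h1 : g * s * g⁻¹ * s⁻¹ ∈ P := hab g s
  have h2 := eq_one_of_conj_eq_mul (y := s) (e := g) (f := g⁻¹ * (s * g * s⁻¹ * g⁻¹) * g) hs
    (by group) (h _ ?_) (hP.exists_pow_eq_one ?_)
  · have h3 : g⁻¹ * (s * g * s⁻¹) = 1 := by rw [← h2]; group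
    rw [inv_mul_eq_one] at h3
    nth_rw 1 [h3]
    group
  all_goals
    have := Subgroup.Normal.conj_mem (inferInstance : P.Normal) _ (hab s g) g⁻¹
    rwa [inv_inv] at this

omit hp [Finite G] [P.Normal] in
theorem mem_center_of_mem_sup_center {s : G} (hs : p.Coprime (orderOf s)) {u z : G} (hu : u ∈ P)
    (hz : z ∈ Subgroup.center G) (h : s = u * z) : s ∈ Subgroup.center G := by
  obtain ⟨k, hk⟩ := hP.exists_pow_eq_one hu
  refine mem_of_pow_mem_of_coprime hs _ (j := k) ?_
  have h1 : Commute u z := Subgroup.mem_center_iff.1 hz u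
  rw [h, h1.mul_pow, hk, one_mul]
  exact pow_mem hz _

/-- If a `p'`-element `s` does not centralise `P` then `sP` consists of vanishing elements. -/
theorem IsVanishing.mul_of_not_commute (hab : ∀ a b : G, a * b * a⁻¹ * b⁻¹ ∈ P) {s : G}
    (hs : p.Coprime (orderOf s)) (hns : ∃ x ∈ P, ¬ Commute s x) {u : G} (hu : u ∈ P) :
    IsVanishing G (s * u) := by
  let S : Set (Subgroup G) := {E | E.Normal ∧ E ≤ P ∧ ∃ x ∈ E, ¬ Commute s x}
  obtain ⟨E, ⟨hEn, hEP, hEs⟩, hEmin⟩ : ∃ E, Minimal (· ∈ S) E :=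
    Set.Finite.exists_minimal (Set.toFinite S) ⟨P, inferInstance, le_rfl, hns⟩
  let F : Subgroup G := (E ⊓ Subgroup.centralizer {s}).normalCore
  have hFle : F ≤ E ⊓ Subgroup.centralizer {s} := Subgroup.normalCore_le _
  have hFE : F ≤ E := hFle.trans inf_le_left
  have hFs : ∀ x ∈ F, Commute s x := fun x hx ↦
    (mem_centralizer_singleton_iff_commute.1 (hFle hx).2).symm
  have hF : ∀ K : Subgroup G, K.Normal → K ≤ E → K = E ∨ K ≤ F := by
    intro K hK hKE
    by_cases hKs : ∃ x ∈ K, ¬ Commute s x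
    · exact Or.inl (le_antisymm hKE (hEmin ⟨hK, hKE.trans hEP, hKs⟩ hKE))
    · push Not at hKs
      refine Or.inr ((Subgroup.normal_le_normalCore (N := K)).2 (le_inf hKE fun x hx ↦ ?_))
      exact mem_centralizer_singleton_iff_commute.2 (hKs x hx).symm
  set π := QuotientGroup.mk' F with hπ
  have hsurj : Function.Surjective π := QuotientGroup.mk'_surjective F
  have hker : ∀ x, π x = 1 ↔ x ∈ F := fun x ↦ QuotientGroup.eq_one_iff x
  have hEbn : (E.map π).Normal := hEn.map _ hsurj
  have hEne : E.map π ≠ ⊥ := by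
    obtain ⟨x, hx, hxs⟩ := hEs
    intro h
    apply hxs
    apply hFs
    rw [← hker, ← Subgroup.mem_bot, ← h]
    exact ⟨x, hx, rfl⟩
  have hmin : ∀ K : Subgroup (G ⧸ F), K.Normal → K ≤ E.map π → K = E.map π ∨ K = ⊥ := by
    intro K hK hKE
    have hle : K.comap π ≤ E := by
      intro x hx
      obtain ⟨e, he, hex⟩ := hKE hx
      have : e⁻¹ * x ∈ F := by rw [← hker, map_mul, map_inv, hex, inv_mul_cancel]
      have := mul_mem he (hFE this)
      rwa [mul_inv_cancel_left] at this
    rcases hF _ (hK.comap π) hle with h | h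
    · left
      exact (Subgroup.map_comap_eq_self_of_surjective hsurj K).symm.trans
        (congrArg (Subgroup.map π) h)
    · right
      rw [eq_bot_iff]
      intro k hk
      obtain ⟨x, rfl⟩ := hsurj k
      rw [Subgroup.mem_bot, hker]
      exact h hk
  have hcP : ∀ e ∈ E.map π, ∀ u ∈ P.map π, Commute u e := by
    have hPn : (P.map π).Normal := Subgroup.Normal.map inferInstance _ hsurj
    have hle : E.map π ⊓ Subgroup.centralizer (P.map π : Set (G ⧸ F)) = E.map π := by
      rcases hmin (E.map π ⊓ Subgroup.centralizer (P.map π : Set (G ⧸ F)))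
        inferInstance inf_le_left with h | h
      · exact h
      · exfalso
        obtain ⟨e, he, hne, hc⟩ := exists_ne_one_forall_commute (P.map π) (E.map π) (hP.map π)
          ((hP.to_le hEP).map π) hEne
        apply hne
        rw [← Subgroup.mem_bot, ← h]
        exact ⟨he, fun u hu ↦ hc u hu⟩
    intro e he u hu
    rw [← hle] at he
    exact he.2 u hu
  have hcs : ∀ e ∈ E, Commute (π e) (π s) → Commute s e := by
    intro e he hes
    have h1 : s * e * s⁻¹ = e * (e⁻¹ * (s * e * s⁻¹)) := by group
    have h2 : e⁻¹ * (s * e * s⁻¹) ∈ F := by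
      rw [← hker]
      simp only [map_mul, map_inv]
      rw [← hes.eq]
      group
    have h3 := eq_one_of_conj_eq_mul hs h1 (hFs _ h2) (hP.exists_pow_eq_one (hEP (hFE h2)))
    rw [h3, mul_one] at h1
    exact mul_inv_eq_iff_eq_mul.1 h1
  have hfix : ∀ e ∈ E.map π, Commute e (π s) → e = 1 := by
    have hn : (E.map π ⊓ Subgroup.centralizer {π s}).Normal := by
      constructor
      rintro e ⟨he, hes⟩ g
      refine ⟨hEbn.conj_mem e he g, mem_centralizer_singleton_iff_commute.2 ?_⟩
      replace hes : Commute e (π s) := mem_centralizer_singleton_iff_commute.1 hes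
      have h1 : g⁻¹ * π s * g * (π s)⁻¹ ∈ P.map π := by
        obtain ⟨g, rfl⟩ := hsurj g
        refine ⟨g⁻¹ * s * g⁻¹⁻¹ * s⁻¹, hab _ _, ?_⟩
        simp
      have h2 : Commute e (g⁻¹ * π s * g) := by
        have := (hcP e he _ h1).symm.mul_right hes
        rwa [inv_mul_cancel_right] at this
      calc g * e * g⁻¹ * π s = g * (e * (g⁻¹ * π s * g)) * g⁻¹ := by group
        _ = π s * (g * e * g⁻¹) := by rw [h2.eq]; group
    rcases hmin _ hn inf_le_left with h | h
    · exfalso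
      obtain ⟨x, hx, hxs⟩ := hEs
      apply hxs
      apply hcs x hx
      have : π x ∈ E.map π := ⟨x, hx, rfl⟩
      rw [← h] at this
      exact mem_centralizer_singleton_iff_commute.1 this.2
    · intro e he hes
      rw [← Subgroup.mem_bot, ← h]
      exact ⟨he, mem_centralizer_singleton_iff_commute.2 hes⟩
  refine IsVanishing.of_surjective π hsurj ?_
  refine IsVanishing.of_forall_isConj_mul (E.map π) hEne _ fun e he ↦ ?_
  have hk : ∀ k ∈ E.map π, Commute k (π (s * u)) → k = 1 := by
    intro k hk hks
    refine hfix k hk ?_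
    have h1 : Commute k (π u)⁻¹ := (hcP k hk _ ⟨u, hu, rfl⟩).symm.inv_right
    have := hks.mul_right h1
    rwa [map_mul, mul_inv_cancel_right] at this
  obtain ⟨k, -, h1⟩ := exists_mul_eq_conj (E.map π) (π (s * u)) hk
    (hEbn.conj_mem e he (π (s * u)))
  rw [inv_mul_cancel_right] at h1
  rw [h1]
  exact isConj_iff.2 ⟨k⁻¹, by group⟩

end

section

variable {p : ℕ} [hp : Fact p.Prime] {G : Type} [Group G] [Finite G] (P : Subgroup G) [P.Normal]
  (hP : IsPGroup p P)

omit [P.Normal] in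
theorem exists_mul_commute_of_classSize_eq {n : ℕ} (hi : ¬ p ∣ P.index) {x : G}
    (hx : classSize x = p ^ n) (g : G) : ∃ u ∈ P, ∃ c, Commute c x ∧ g = u * c := by
  have h : P.index.Coprime (Subgroup.centralizer {x}).index := by
    have h1 : (Subgroup.centralizer {x}).index = p ^ n := hx
    rw [h1]
    exact (Nat.Coprime.pow_left _ ((Nat.Prime.coprime_iff_not_dvd hp.out).2 hi)).symm
  obtain ⟨u, hu, c, hc, h2⟩ := exists_mul_eq_of_coprime_index _ _ h g
  exact ⟨u, hu, c, mem_centralizer_singleton_iff_commute.1 hc, h2⟩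

include hP

/-- If a `p'`-element `y` centralises `C_P(x)` with `x ∈ P` and commutes with `x`, then it
centralises `P`. -/
theorem commute_of_forall_commute_of_commute {x y : G} (hx : x ∈ P) (hyx : Commute y x)
    (hy : p.Coprime (orderOf y)) (h : ∀ u ∈ P, Commute u x → Commute y u) :
    ∀ u ∈ P, Commute y u := by
  have key : ∀ n : ℕ, ∀ u : P, u ∈ Subgroup.upperCentralSeries P n → Commute y (u : G) := by
    intro n
    induction n with
    | zero =>
      intro u hu
      rw [Subgroup.upperCentralSeries_zero, Subgroup.mem_bot] at hu
      rw [hu]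
      exact Commute.one_right y
    | succ n ih =>
      intro u hu
      have h1 := ih _ (Subgroup.mem_upperCentralSeries_succ_iff.1 hu ⟨x, hx⟩)
      have h2 : y * ((u : G) * x * (u : G)⁻¹ * x⁻¹) * y⁻¹ = (u : G) * x * (u : G)⁻¹ * x⁻¹ :=
        mul_inv_eq_iff_eq_mul.2 h1.eq
      have hd : (u : G)⁻¹ * (y * u * y⁻¹) ∈ P :=
        mul_mem (inv_mem u.2) (Subgroup.Normal.conj_mem inferInstance _ u.2 _)
      have hdx : Commute ((u : G)⁻¹ * (y * u * y⁻¹)) x := by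
        have h3 : y * x * y⁻¹ = x := mul_inv_eq_iff_eq_mul.2 hyx.eq
        have h4 : (y * u * y⁻¹) * (y * x * y⁻¹) * (y * u * y⁻¹)⁻¹ * (y * x * y⁻¹)⁻¹ =
            (u : G) * x * (u : G)⁻¹ * x⁻¹ := by
          rw [← h2]; group
        rw [h3] at h4
        have h5 := mul_right_cancel h4
        have h6 : (u : G)⁻¹ * ((y * u * y⁻¹) * x * (y * u * y⁻¹)⁻¹) * u = x := by
          rw [h5]; group
        have h7 : ((u : G)⁻¹ * (y * u * y⁻¹)) * x * ((u : G)⁻¹ * (y * u * y⁻¹))⁻¹ = x := by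
          nth_rw 2 [← h6]; group
        exact mul_inv_eq_iff_eq_mul.1 h7
      have h8 := eq_one_of_conj_eq_mul (e := (u : G)) hy (by group) (h _ hd hdx)
        (hP.exists_pow_eq_one hd)
      exact mul_inv_eq_iff_eq_mul.1 (inv_mul_eq_one.1 h8).symm
  intro u hu
  have hnil : Group.IsNilpotent P := hP.isNilpotent
  obtain ⟨n, hn⟩ := Group.IsNilpotent.nilpotent P
  exact key n ⟨u, hu⟩ (by rw [hn]; trivial)

theorem not_isVanishing_of_mem_of_not_commute {n : ℕ} (hi : ¬ p ∣ P.index)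
    (hab : ∀ a b : G, a * b * a⁻¹ * b⁻¹ ∈ P) (hv : ∀ g, IsVanishing G g → classSize g = p ^ n)
    {s : G} (hs : p.Coprime (orderOf s)) (hns : ∃ x ∈ P, ¬ Commute s x) {x : G} (hx : x ∈ P) :
    ¬ IsVanishing G x := by
  intro hxv
  have hxn := hv x hxv
  have hcen : ∀ y, Commute y x → p.Coprime (orderOf y) → y ∈ Subgroup.center G := by
    intro y hyx hy
    refine mem_center_of_forall_commute P hP hab hy ?_
    by_contra hcon
    push Not at hcon
    have h1 := hv _ (IsVanishing.mul_of_not_commute P hP hab hy hcon hx)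
    obtain ⟨u, hu, hyu⟩ := hcon
    obtain ⟨k, hk⟩ := hP.exists_pow_eq_one hx
    have hc : (orderOf x).Coprime (orderOf y) :=
      Nat.Coprime.coprime_dvd_left (orderOf_dvd_of_pow_eq_one hk) (hy.pow_left k)
    rw [hyx.eq] at h1
    have h2 := centralizer_le_of_classSize_mul_le hyx.symm hc (by rw [h1, hxn])
    refine hyu (commute_of_forall_commute_of_commute P hP hx hyx hy (fun u _ hux ↦ ?_) u hu)
    exact (mem_centralizer_singleton_iff_commute.1
      (h2 (mem_centralizer_singleton_iff_commute.2 hux))).symm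
  obtain ⟨v, hv, c, hc, hsv⟩ := exists_mul_commute_of_classSize_eq P hi hxn s
  obtain ⟨a, b, h1, h2, h3⟩ := exists_pow_mul_pow_eq p hp.out c
  have h4 : c ^ a ∈ P := mem_of_pow_eq_one_of_not_dvd_index P hi h2
  have h5 : c ^ b ∈ Subgroup.center G := hcen _ (hc.pow_left b) h3
  have h6 := mem_center_of_mem_sup_center P hP hs (mul_mem hv h4) h5
    (by rw [mul_assoc, h1, hsv])
  obtain ⟨y, -, hy⟩ := hns
  exact hy (Subgroup.mem_center_iff.1 h6 y).symm

/-- Outside `P Z(G)` the `p'`-part of an element does not centralise `P`. -/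
theorem exists_not_commute_of_notMem (hi : ¬ p ∣ P.index)
    (hab : ∀ a b : G, a * b * a⁻¹ * b⁻¹ ∈ P) {g : G} (hg : g ∉ P ⊔ Subgroup.center G) :
    ∃ b : ℕ, p.Coprime (orderOf (g ^ b)) ∧ ∃ x ∈ P, ¬ Commute (g ^ b) x := by
  obtain ⟨a, b, h1, h2, h3⟩ := exists_pow_mul_pow_eq p hp.out g
  refine ⟨b, h3, ?_⟩
  by_contra hcon
  push Not at hcon
  apply hg
  rw [← h1]
  exact mul_mem (Subgroup.mem_sup_left (mem_of_pow_eq_one_of_not_dvd_index P hi h2))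
    (Subgroup.mem_sup_right (mem_center_of_forall_commute P hP hab h3 hcon))

theorem isFrobenius_of_not_commute {n : ℕ} (hn : 0 < n) (hi : ¬ p ∣ P.index)
    (hab : ∀ a b : G, a * b * a⁻¹ * b⁻¹ ∈ P) (hv : ∀ g, IsVanishing G g → classSize g = p ^ n)
    {s : G} (hs : p.Coprime (orderOf s)) (hns : ∃ x ∈ P, ¬ Commute s x)
    (H : Subgroup G) (hH : ¬ p ∣ Nat.card H) (hPH : P ⊔ H = ⊤) :
    IsFrobenius (P.map (QuotientGroup.mk' (Subgroup.center G)))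
        (H.map (QuotientGroup.mk' (Subgroup.center G))) ∧
      Nat.card (P.map (QuotientGroup.mk' (Subgroup.center G))) = p ^ n := by
  set π := QuotientGroup.mk' (Subgroup.center G) with hπ
  have hsurj : Function.Surjective π := QuotientGroup.mk'_surjective _
  have hker : ∀ x, π x = 1 ↔ x ∈ Subgroup.center G := fun x ↦ QuotientGroup.eq_one_iff x
  have hnv : ∀ x ∈ P, ¬ IsVanishing G x := fun x hx ↦
    not_isVanishing_of_mem_of_not_commute P hP hi hab hv hs hns hx
  have hcen : ∀ t, p.Coprime (orderOf t) → (∃ x ∈ P, ¬ Commute t x) → ∀ u ∈ P, Commute u t →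
      u ∈ Subgroup.center G := by
    intro t ht hnt u hu hut
    have h1 : IsVanishing G (t * 1) := IsVanishing.mul_of_not_commute P hP hab ht hnt P.one_mem
    have h2 := IsVanishing.mul_of_not_commute P hP hab ht hnt hu
    rw [mul_one] at h1
    have htn := hv _ h1
    obtain ⟨k, hk⟩ := hP.exists_pow_eq_one hu
    have hc : (orderOf t).Coprime (orderOf u) :=
      (Nat.Coprime.coprime_dvd_left (orderOf_dvd_of_pow_eq_one hk) (ht.pow_left k)).symm
    have h3 := centralizer_le_of_classSize_mul_le hut.symm hc (by rw [hv _ h2, htn])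
    have hG : ∀ g, ∃ v ∈ P, ∃ c, Commute c u ∧ g = v * c := by
      intro g
      obtain ⟨v, hv, c, hc, hg⟩ := exists_mul_commute_of_classSize_eq P hi htn g
      exact ⟨v, hv, c, mem_centralizer_singleton_iff_commute.1
        (h3 (mem_centralizer_singleton_iff_commute.2 hc)), hg⟩
    have h4 : ∀ v ∈ P, Commute v u := by
      by_contra hcon
      push Not at hcon
      exact hnv u hu (IsVanishing.of_mem_isPGroup hp.out P hP hu hcon hG)
    rw [Subgroup.mem_center_iff]
    intro g
    obtain ⟨v, hv, c, hc, rfl⟩ := hG g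
    exact ((h4 v hv).mul_left hc).eq
  have hcard : Nat.card (P.map π) = p ^ n := by
    have h1 : IsVanishing G (s * 1) := IsVanishing.mul_of_not_commute P hP hab hs hns P.one_mem
    rw [mul_one] at h1
    rw [← Subgroup.relIndex_ker, hπ, QuotientGroup.ker_mk', ← hv s h1,
      ← relIndex_eq_classSize P (exists_mul_commute_of_classSize_eq P hi (hv s h1)),
      ← Subgroup.inf_relIndex_right, ← Subgroup.inf_relIndex_right (Subgroup.centralizer {s})]
    congr 1
    apply le_antisymm
    · rintro x ⟨hx, hxP⟩
      exact ⟨mem_centralizer_singleton_iff_commute.2 (Subgroup.mem_center_iff.1 hx s).symm, hxP⟩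
    · rintro x ⟨hx, hxP⟩
      exact ⟨hcen s hs hns x hxP (mem_centralizer_singleton_iff_commute.1 hx), hxP⟩
  have hnorm : (P.map π).Normal := Subgroup.Normal.map inferInstance _ hsurj
  have hmem : ∀ g, π g ∈ P.map π → g ∈ P ⊔ Subgroup.center G := by
    rintro g ⟨x, hx, hxg⟩
    have h1 : x⁻¹ * g ∈ Subgroup.center G := by
      rw [← hker, map_mul, map_inv, hxg, inv_mul_cancel]
    have := mul_mem (Subgroup.mem_sup_left hx : x ∈ P ⊔ Subgroup.center G)
      (Subgroup.mem_sup_right h1)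
    rwa [mul_inv_cancel_left] at this
  refine ⟨⟨⟨?_, ?_, hnorm, ?_⟩, ?_, ?_⟩, hcard⟩
  · intro h
    rw [h, Subgroup.card_bot] at hcard
    exact (Nat.one_lt_pow hn.ne' hp.out.one_lt).ne hcard
  · intro h
    have h1 := hmem s (by rw [h]; trivial)
    rw [Subgroup.mem_sup_of_normal_left] at h1
    obtain ⟨u, hu, z, hz, hs'⟩ := h1
    have h2 := mem_center_of_mem_sup_center P hP hs hu hz hs'.symm
    obtain ⟨y, -, hy⟩ := hns
    exact hy (Subgroup.mem_center_iff.1 h2 y).symm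
  · rintro k ⟨x, hx, rfl⟩ hk g hg
    obtain ⟨g, rfl⟩ := hsurj g
    by_contra hgP
    have hgZ : g ∉ P ⊔ Subgroup.center G := by
      intro h1
      apply hgP
      rw [Subgroup.mem_sup_of_normal_left] at h1
      obtain ⟨u, hu, z, hz, rfl⟩ := h1
      exact ⟨u, hu, by rw [map_mul, (hker z).2 hz, mul_one]⟩
    obtain ⟨b, hb, hnb⟩ := exists_not_commute_of_notMem P hP hi hab hgZ
    have h1 : Commute (π (g ^ b)) (π x) := by
      rw [map_pow]
      exact (mem_centralizer_singleton_iff_commute.1 hg).pow_left b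
    have h2 : x⁻¹ * (g ^ b * x * (g ^ b)⁻¹) ∈ Subgroup.center G := by
      rw [← hker]
      simp only [map_mul, map_inv]
      rw [h1.eq]
      group
    have h3 : x⁻¹ * (g ^ b * x * (g ^ b)⁻¹) ∈ P :=
      mul_mem (inv_mem hx) (Subgroup.Normal.conj_mem inferInstance _ hx _)
    have h4 := eq_one_of_conj_eq_mul (e := x) hb (by group) (Subgroup.mem_center_iff.1 h2 _)
      (hP.exists_pow_eq_one h3)
    have h5 : Commute (g ^ b) x := mul_inv_eq_iff_eq_mul.1 (inv_mul_eq_one.1 h4).symm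
    exact hk ((hker x).2 (hcen _ hb hnb x hx h5.symm))
  · rw [← Subgroup.map_sup, hPH, Subgroup.map_top_of_surjective _ hsurj]
  · refine (Subgroup.disjoint_of_coprime_natCard ?_).eq_bot
    rw [hcard]
    apply Nat.Coprime.pow_left
    rw [Nat.Prime.coprime_iff_not_dvd hp.out]
    exact fun h ↦ hH (h.trans (Subgroup.card_map_dvd _ _))

omit hp [Finite G] in
theorem cs_eq_of_forall_commute [Finite G] {n : ℕ} (hp : p.Prime) (hv : vcs G = {p ^ n})
    (H : Subgroup G) (hPH : P ⊔ H = ⊤) (hab : IsAbelianSubgroup H)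
    (hc : ∀ h ∈ H, ∀ x ∈ P, Commute h x) :
    cs P = {1, p ^ n} := by
  have hG : ∀ x ∈ P, ∀ g, ∃ u ∈ P, ∃ c, Commute c x ∧ g = u * c := by
    intro x hx g
    obtain ⟨u, hu, h, hh, hg⟩ := exists_mul_eq_of_sup_eq_top hPH g
    exact ⟨u, hu, h, hc h hh x hx, hg⟩
  have hcl : ∀ x : P, classSize x = classSize (x : G) := fun x ↦ by
    rw [classSize_subtype, relIndex_eq_classSize P (hG x x.2)]
  apply Set.Subset.antisymm
  · rintro m ⟨x, rfl⟩
    by_cases hx : x ∈ Subgroup.center P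
    · exact Or.inl (classSize_eq_one_iff.2 hx)
    · refine Or.inr ?_
      rw [Set.mem_singleton_iff, hcl]
      have h1 : IsVanishing G (x : G) := by
        refine IsVanishing.of_mem_isPGroup hp P hP x.2 ?_ (hG x x.2)
        rw [Subgroup.mem_center_iff] at hx
        push Not at hx
        obtain ⟨u, hu⟩ := hx
        exact ⟨u, u.2, fun h ↦ hu (Subtype.ext h.eq)⟩
      have h2 : classSize (x : G) ∈ vcs G := ⟨x, h1, rfl⟩
      rwa [hv] at h2
  · rintro m (rfl | hm)
    · exact ⟨1, classSize_eq_one_iff.2 (one_mem _)⟩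
    · have hm' : m ∈ vcs G := by rw [hv]; exact hm
      obtain ⟨g, hg, hgm⟩ := hm'
      obtain ⟨u, hu, h, hh, rfl⟩ := exists_mul_eq_of_sup_eq_top hPH g
      have hz : h ∈ Subgroup.center G := by
        rw [Subgroup.mem_center_iff]
        intro g
        obtain ⟨v, hv, k, hk, rfl⟩ := exists_mul_eq_of_sup_eq_top hPH g
        exact ((hc h hh v hv).symm.mul_left (hab k hk h hh)).eq
      refine ⟨⟨u, hu⟩, ?_⟩
      rw [hcl, ← hgm, classSize_mul_mem_center u hz]

theorem structure_of_vcs_eq {n : ℕ} (hn : 0 < n) (hi : ¬ p ∣ P.index)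
    (hab : ∀ a b : G, a * b * a⁻¹ * b⁻¹ ∈ P) (hv : vcs G = {p ^ n}) :
    ∃ P H : Subgroup G, P.Normal ∧ IsPGroup p ↥P ∧ ¬ p ∣ P.index ∧
        (∃ k : ℕ, H.index = p ^ k) ∧ ¬ p ∣ Nat.card H ∧
        IsAbelianSubgroup H ∧ P ⊔ H = ⊤ ∧
        (((∀ h ∈ H, ∀ x ∈ P, Commute h x) ∧ cs ↥P = {1, p ^ n}) ∨
         (IsFrobenius (P.map (QuotientGroup.mk' (Subgroup.center G)))
            (H.map (QuotientGroup.mk' (Subgroup.center G))) ∧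
          Nat.card (P.map (QuotientGroup.mk' (Subgroup.center G))) = p ^ n ∧
          ∀ x ∈ P, ¬ IsVanishing G x)) := by
  have hv' : ∀ g, IsVanishing G g → classSize g = p ^ n := by
    intro g hg
    have : classSize g ∈ vcs G := ⟨g, hg, rfl⟩
    rwa [hv] at this
  obtain ⟨k, hk⟩ := IsPGroup.iff_card.1 hP
  have hcop : (Nat.card P).Coprime P.index := by
    rw [hk]
    exact Nat.Coprime.pow_left _ ((Nat.Prime.coprime_iff_not_dvd hp.out).2 hi)
  obtain ⟨H, hH⟩ := Subgroup.exists_right_complement'_of_coprime hcop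
  have hPH : P ⊔ H = ⊤ := hH.sup_eq_top
  have hHc : ¬ p ∣ Nat.card H := by rwa [← hH.symm.index_eq_card]
  have hHi : H.index = p ^ k := by rw [hH.index_eq_card, hk]
  have hHab : IsAbelianSubgroup H := by
    intro a ha b hb
    have h1 : a * b * a⁻¹ * b⁻¹ ∈ P ⊓ H :=
      ⟨hab a b, H.mul_mem (H.mul_mem (H.mul_mem ha hb) (H.inv_mem ha)) (H.inv_mem hb)⟩
    rw [hH.isCompl.inf_eq_bot, Subgroup.mem_bot] at h1
    have h2 := mul_inv_eq_one.1 h1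
    exact mul_inv_eq_iff_eq_mul.1 h2
  refine ⟨P, H, inferInstance, hP, hi, ⟨k, hHi⟩, hHc, hHab, hPH, ?_⟩
  by_cases hs : ∃ s, p.Coprime (orderOf s) ∧ ∃ x ∈ P, ¬ Commute s x
  · obtain ⟨s, hs, hns⟩ := hs
    obtain ⟨h1, h2⟩ := isFrobenius_of_not_commute P hP hn hi hab hv' hs hns H hHc hPH
    exact Or.inr ⟨h1, h2, fun x hx ↦
      not_isVanishing_of_mem_of_not_commute P hP hi hab hv' hs hns hx⟩
  · push Not at hs
    have hc : ∀ h ∈ H, ∀ x ∈ P, Commute h x := by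
      intro h hh
      refine hs h ?_
      rw [Nat.Prime.coprime_iff_not_dvd hp.out]
      exact fun h1 ↦ hHc (h1.trans (Subgroup.orderOf_dvd_natCard H hh))
    exact Or.inl ⟨hc, cs_eq_of_forall_commute P hP hp.out hv H hPH hHab hc⟩

end

theorem relIndex_centralizer_dvd_classSize {G : Type*} [Group G] [Finite G] (N : Subgroup G)
    [N.Normal] (x : G) : (Subgroup.centralizer {x}).relIndex N ∣ classSize x := by
  rw [relIndex_eq_relIndex_sup]
  exact Dvd.intro _ (Subgroup.relIndex_mul_index le_sup_left)

theorem commute_of_finrank_le_one {G V : Type} [Group G] [AddCommGroup V] [Module ℂ V]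
    [FiniteDimensional ℂ V] (ρ : Representation ℂ G V) (h : Module.finrank ℂ V ≤ 1) (a b : G) :
    ρ (a * b) = ρ (b * a) := by
  obtain ⟨v, hv⟩ := finrank_le_one_iff.1 h
  obtain ⟨x, hx⟩ := hv (ρ a v)
  obtain ⟨y, hy⟩ := hv (ρ b v)
  ext w
  obtain ⟨c, rfl⟩ := hv w
  simp only [map_mul, Module.End.mul_apply, map_smul, ← hx, ← hy]
  rw [smul_comm x y]

/-- In a finite group with a normal subgroup contained in every nontrivial normal subgroup, a
representation which is nontrivial on it is faithful. -/
theorem eq_one_of_apply_eq_one {G V : Type} [Group G] [AddCommGroup V] [Module ℂ V]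
    {N : Subgroup G} (hmin : ∀ K : Subgroup G, K.Normal → K ≠ ⊥ → N ≤ K)
    (ρ : Representation ℂ G V) (hρ : ∃ e ∈ N, ρ e ≠ 1) {g : G} (hg : ρ g = 1) : g = 1 := by
  obtain ⟨e, he, hne⟩ := hρ
  by_contra hg1
  refine hne (hmin (MonoidHom.ker ρ) inferInstance (fun h ↦ hg1 ?_) he)
  rw [← Subgroup.mem_bot, ← h]
  exact hg

/-- If all vanishing elements lie in `C` then irreducible representations restrict irreducibly
to `C`. -/
theorem isIrreducible_comp_subtype_of_isVanishing {G V : Type} [Group G] [Finite G]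
    [AddCommGroup V] [Module ℂ V] [FiniteDimensional ℂ V] (ρ : Representation ℂ G V)
    (h : ρ.IsIrreducible) (C : Subgroup G) (hC : ∀ g, IsVanishing G g → g ∈ C) :
    Representation.IsIrreducible (ρ.comp C.subtype) := by
  have : Fintype G := Fintype.ofFinite G
  have hnt : Nontrivial V := ((isIrreducible_iff_forall_submodule ρ).1 h).1
  have h1 := card_le_sum_norm_sq_character ρ (Finset.univ.filter (· ∉ C)) (by
    intro g hg j hj
    simp only [Finset.mem_filter, Finset.mem_univ, true_and] at hg ⊢
    intro h2
    obtain ⟨m, hm⟩ := exists_pow_eq_self_of_coprime (x := g)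
      (hj.coprime_dvd_right (orderOf_dvd_natCard g))
    exact hg (hm ▸ pow_mem h2 m)) (by
    intro g hg h0
    simp only [Finset.mem_filter, Finset.mem_univ, true_and] at hg
    exact hg (hC g (IsVanishing.of_isIrreducible ρ h h0)))
  have h2 := sum_norm_sq_character ρ h
  have h3 := sum_norm_sq_character_subgroup ρ C
  rw [← Finset.sum_filter_add_sum_filter_not Finset.univ (· ∈ C)] at h2
  have h4 : ∑ g ∈ Finset.univ.filter (· ∈ C), ‖ρ.character g‖ ^ 2 =
      ∑ g : C, ‖ρ.character (g : G)‖ ^ 2 := by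
    rw [← Finset.sum_subtype_of_mem (p := (· ∈ C)) (fun g ↦ ‖ρ.character g‖ ^ 2)
      (s := Finset.univ.filter (· ∈ C)) (by simp)]
    apply Finset.sum_congr
    · ext x; simp
    · intros; rfl
  have h5 : (Finset.univ.filter (· ∈ C)).card = Nat.card C := by
    rw [Nat.card_eq_fintype_card, Fintype.card_subtype]
  have h6 : (Finset.univ.filter (· ∈ C)).card + (Finset.univ.filter (· ∉ C)).card =
      Nat.card G := by
    rw [Nat.card_eq_fintype_card, Finset.card_filter_add_card_filter_not, Finset.card_univ]
  apply isIrreducible_of_finrank_intertwiningMap_eq_one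
  rw [h4, h3] at h2
  set d := Module.finrank ℂ (Representation.IntertwiningMap (MonoidHom.comp ρ C.subtype)
    (MonoidHom.comp ρ C.subtype)) with hd
  have h7 : (Nat.card C : ℝ) * d ≤ Nat.card C := by
    rw [← h6, h5] at h2
    push_cast at h2
    linarith
  have h8 : Nat.card C * d ≤ Nat.card C * 1 := by
    rw [mul_one]
    exact_mod_cast h7
  have h9 := Nat.le_of_mul_le_mul_left h8 Nat.card_pos
  have h10 : d ≠ 0 := by
    intro h0
    have h11 := Module.finrank_zero_iff.1 (hd.symm.trans h0)
    obtain ⟨v, hv⟩ := exists_ne (0 : V)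
    apply hv
    have h12 := Subsingleton.elim
      (Representation.IntertwiningMap.id (MonoidHom.comp ρ C.subtype)) 0
    exact DFunLike.congr_fun h12 v
  omega

section

variable {p : ℕ} [hp : Fact p.Prime] {X : Type} [Group X] [Finite X] {N : Subgroup X} [N.Normal]

theorem not_dvd_card_of_commute (hmin : ∀ K : Subgroup X, K.Normal → K ≠ ⊥ → N ≤ K)
    (hNp : ¬ IsPGroup p N) (hab : ∀ a ∈ N, ∀ b ∈ N, Commute a b) : ¬ p ∣ Nat.card N := by
  intro hdvd
  obtain ⟨x, hx⟩ := exists_prime_orderOf_dvd_card' p hdvd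
  let T : Subgroup X :=
    { carrier := {e | e ∈ N ∧ ∃ k, e ^ p ^ k = 1}
      one_mem' := ⟨one_mem _, 0, one_pow _⟩
      mul_mem' := by
        rintro a b ⟨ha, k, hk⟩ ⟨hb, l, hl⟩
        refine ⟨mul_mem ha hb, k + l, ?_⟩
        rw [(hab a ha b hb).mul_pow, pow_add, pow_mul, hk, one_pow, mul_comm, pow_mul, hl,
          one_pow, one_mul]
      inv_mem' := by
        rintro a ⟨ha, k, hk⟩
        exact ⟨inv_mem ha, k, by rw [inv_pow, hk, inv_one]⟩ }
  have hT : T.Normal := by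
    constructor
    rintro a ⟨ha, k, hk⟩ g
    exact ⟨Subgroup.Normal.conj_mem inferInstance a ha g, k, by rw [conj_pow, hk]; simp⟩
  have hxT : (x : X) ∈ T := ⟨x.2, 1, by
    rw [pow_one, ← hx, ← Subgroup.orderOf_coe, pow_orderOf_eq_one]⟩
  have hx1 : (x : X) ≠ 1 := by
    intro h
    rw [← Subgroup.orderOf_coe, h, orderOf_one] at hx
    exact hp.out.one_lt.ne hx
  have hNT := hmin T hT (fun h ↦ hx1 (by rwa [h, Subgroup.mem_bot] at hxT))
  apply hNp
  rw [isPGroup_iff_pow_pow_eq_one]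
  intro e
  obtain ⟨-, k, hk⟩ := hNT e.2
  exact ⟨k, Subtype.ext hk⟩

omit [N.Normal] in
/-- If the unique minimal normal subgroup `N` is a central `p'`-subgroup and the derived subgroup is
a `p`-group modulo `N`, then the derived subgroup is contained in `N`. -/
theorem commutator_le_of_le_center (hmin : ∀ K : Subgroup X, K.Normal → K ≠ ⊥ → N ≤ K)
    (hNc : ¬ p ∣ Nat.card N) (hN : N ≤ Subgroup.center X) (hne : N ≠ ⊥)
    (hc : ∀ x ∈ commutator X, ∃ k, x ^ p ^ k ∈ N) : commutator X ≤ N := by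
  set Y := commutator X
  have hcen : ∀ y : Y, ∃ k, y ^ p ^ k ∈ Subgroup.center Y := by
    intro y
    obtain ⟨k, hk⟩ := hc y y.2
    refine ⟨k, Subgroup.mem_center_iff.2 fun g ↦ Subtype.ext ?_⟩
    exact Subgroup.mem_center_iff.1 (hN hk) g
  have hpg : IsPGroup p (Y ⧸ Subgroup.center Y) := by
    rw [isPGroup_iff_pow_pow_eq_one]
    intro q
    obtain ⟨y, rfl⟩ := QuotientGroup.mk_surjective q
    obtain ⟨k, hk⟩ := hcen y
    exact ⟨k, by rwa [← QuotientGroup.mk_pow, QuotientGroup.eq_one_iff]⟩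
  obtain ⟨j, hj⟩ := IsPGroup.iff_card.1 hpg
  rw [← Subgroup.index_eq_card] at hj
  have hmul : ∀ a b : Y, (a * b) ^ p ^ j = a ^ p ^ j * b ^ p ^ j := by
    intro a b
    have := congrArg (Subtype.val) (map_mul (MonoidHom.transferCenterPow Y) a b)
    rwa [Subgroup.coe_mul, MonoidHom.transferCenterPow_apply, MonoidHom.transferCenterPow_apply,
      MonoidHom.transferCenterPow_apply, hj] at this
  have hcomm : ∀ a b : Y, Commute (a ^ p ^ j) b := by
    intro a b
    have h1 := (MonoidHom.transferCenterPow Y a).2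
    rw [MonoidHom.transferCenterPow_apply, hj] at h1
    exact (Subgroup.mem_center_iff.1 h1 b).symm
  let T : Subgroup X :=
    { carrier := {e | e ∈ Y ∧ ∃ k, e ^ p ^ k = 1}
      one_mem' := ⟨one_mem _, 0, one_pow _⟩
      mul_mem' := by
        rintro a b ⟨ha, k, hk⟩ ⟨hb, l, hl⟩
        refine ⟨mul_mem ha hb, j + (k + l), ?_⟩
        have h1 : (a * b) ^ p ^ j = a ^ p ^ j * b ^ p ^ j :=
          congrArg Subtype.val (hmul ⟨a, ha⟩ ⟨b, hb⟩)
        have h2 : Commute (a ^ p ^ j) (b ^ p ^ j) :=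
          congrArg Subtype.val (hcomm ⟨a, ha⟩ ((⟨b, hb⟩ : Y) ^ p ^ j)).eq
        rw [pow_add, pow_mul, h1, h2.mul_pow, ← pow_mul, ← pow_mul, mul_comm (p ^ j), pow_add,
          pow_mul, pow_mul, hk, mul_comm (p ^ k), pow_mul, pow_mul, hl]
        simp
      inv_mem' := by
        rintro a ⟨ha, k, hk⟩
        exact ⟨inv_mem ha, k, by rw [inv_pow, hk, inv_one]⟩ }
  have hT : T.Normal := by
    constructor
    rintro a ⟨ha, k, hk⟩ g
    exact ⟨Subgroup.Normal.conj_mem inferInstance a ha g, k, by rw [conj_pow, hk]; simp⟩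
  have hTbot : T = ⊥ := by
    by_contra hT1
    have hNT := hmin T hT hT1
    apply hne
    rw [eq_bot_iff]
    intro e he
    obtain ⟨-, k, hk⟩ := hNT he
    refine eq_one_of_pow_eq_one_of_coprime (m := p ^ k) (n := Nat.card N)
      (Nat.Coprime.pow_left _ ((Nat.Prime.coprime_iff_not_dvd hp.out).2 hNc)) hk ?_
    exact congrArg Subtype.val (pow_card_eq_one' (x := (⟨e, he⟩ : N)))
  intro y hy
  obtain ⟨k, hk⟩ := hc y hy
  refine mem_of_pow_mem_of_coprime ?_ N hk
  rw [Nat.Prime.coprime_iff_not_dvd hp.out]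
  intro hdvd
  have h1 : orderOf (y ^ (orderOf y / p)) = p := orderOf_pow_orderOf_div (orderOf_pos y).ne' hdvd
  have h2 : y ^ (orderOf y / p) ∈ T := ⟨pow_mem hy _, 1, by
    rw [pow_one, ← orderOf_dvd_iff_pow_eq_one, h1]⟩
  rw [hTbot, Subgroup.mem_bot] at h2
  rw [h2, orderOf_one] at h1
  exact hp.out.one_lt.ne h1

/-- Vanishing elements whose class sizes are powers of `p` centralize every normal `p'`-subgroup. -/
theorem mem_centralizer_of_isVanishing (hcard : ¬ p ∣ Nat.card N)
    (hv : ∀ g, IsVanishing X g → ∃ k, classSize g = p ^ k) (g : X) (hg : IsVanishing X g) :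
    g ∈ Subgroup.centralizer (N : Set X) := by
  obtain ⟨k, hk⟩ := hv g hg
  have h1 : (Subgroup.centralizer {g}).relIndex N = 1 := by
    refine Nat.eq_one_of_dvd_coprimes (a := p ^ k) (b := Nat.card N)
      (Nat.Coprime.pow_left _ ((Nat.Prime.coprime_iff_not_dvd hp.out).2 hcard)) ?_
      (Subgroup.relIndex_dvd_card _ _)
    rw [← hk]
    exact relIndex_centralizer_dvd_classSize N g
  rw [Subgroup.relIndex_eq_one] at h1
  intro e he
  exact mem_centralizer_singleton_iff_commute.1 (h1 he)

/-- If `N` is a unique minimal normal subgroup, not a `p`-group, the derived subgroup is a `p`-group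
modulo `N`, and vanishing elements have `p`-power class sizes, then `N` is not abelian. -/
theorem exists_not_commute_of_isVanishing
    (hmin : ∀ K : Subgroup X, K.Normal → K ≠ ⊥ → N ≤ K) (hNp : ¬ IsPGroup p N)
    (hNY : N ≤ commutator X) (hc : ∀ x ∈ commutator X, ∃ k, x ^ p ^ k ∈ N)
    (hv : ∀ g, IsVanishing X g → ∃ k, classSize g = p ^ k) :
    ∃ a ∈ N, ∃ b ∈ N, ¬ Commute a b := by
  by_contra hab
  push Not at hab
  have hcard := not_dvd_card_of_commute hmin hNp hab
  have hne : N ≠ ⊥ := by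
    rintro rfl
    exact hNp IsPGroup.of_bot
  have hvC := mem_centralizer_of_isVanishing hcard hv
  obtain ⟨e, he, he1⟩ := N.bot_or_exists_ne_one.resolve_left hne
  obtain ⟨V, _, _, _, ρ, hρ, hρe⟩ := exists_irreducible_apply_ne_one he1
  have hfaith : ∀ g, ρ g = 1 → g = 1 := fun g hg ↦
    eq_one_of_apply_eq_one hmin ρ ⟨e, he, hρe⟩ hg
  have hres := isIrreducible_comp_subtype_of_isVanishing ρ hρ _ hvC
  have hNC : N ≤ Subgroup.centralizer (N : Set X) := fun a ha b hb ↦ hab b hb a ha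
  have hNZ : N ≤ Subgroup.center X := by
    intro a ha
    obtain ⟨c, -, hc⟩ := exists_smul_of_mem_center _ hres (z := ⟨a, hNC ha⟩)
      (Subgroup.mem_center_iff.2 fun g ↦ Subtype.ext (g.2 a ha).symm)
    rw [Subgroup.mem_center_iff]
    intro g
    have h1 : ρ (g * a * (a * g)⁻¹) = 1 := by
      have h2 : ρ (g * a) = ρ (a * g) := by
        ext v
        have hc' : ∀ v, ρ a v = c • v := hc
        simp [hc']
      rw [map_mul, h2, ← map_mul, mul_inv_cancel, map_one]
    exact mul_inv_eq_one.1 (hfaith _ h1)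
  have hYN := commutator_le_of_le_center hmin hcard hNZ hne hc
  have hcomm : ∀ a b : X, a⁻¹ * (b * a * b⁻¹) ∈ N := by
    intro a b
    have := hYN (Subgroup.commutator_mem_commutator (Subgroup.mem_top a⁻¹) (Subgroup.mem_top b))
    rwa [commutatorElement_def, inv_inv, mul_assoc, mul_assoc, ← mul_assoc b] at this
  have hdim : 1 < Module.finrank ℂ V := by
    by_contra hd
    push Not at hd
    have hbot : commutator X = ⊥ := by
      rw [eq_bot_iff, commutator_def, Subgroup.commutator_le]
      intro a _ b _
      apply hfaith
      rw [commutatorElement_def, mul_assoc, ← mul_inv_rev, map_mul,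
        commute_of_finrank_le_one ρ hd, ← map_mul, mul_inv_cancel, map_one]
    exact hne (eq_bot_iff.2 (hbot ▸ hNY))
  obtain ⟨x, hx⟩ := exists_character_eq_zero ρ hρ hdim
  have hxv := IsVanishing.of_isIrreducible ρ hρ hx
  refine not_isVanishing_of_mem_center ?_ hxv
  obtain ⟨k, hk⟩ := hv x hxv
  have hnorm : (Subgroup.centralizer {x}).Normal := by
    constructor
    intro a ha g
    have h1 := hNZ (hcomm a g)
    have h2 : g * a * g⁻¹ = a * (a⁻¹ * (g * a * g⁻¹)) := by group
    rw [h2]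
    refine mul_mem ha ?_
    rw [mem_centralizer_singleton_iff_commute]
    exact (Subgroup.mem_center_iff.1 h1 x).symm
  rw [Subgroup.mem_center_iff]
  intro g
  have h1 : g * x * g⁻¹ = x * (x⁻¹ * (g * x * g⁻¹)) := by group
  have h2 := pow_conj_eq_mul_pow h1 (Subgroup.mem_center_iff.1 (hNZ (hcomm x g)) g) (p ^ k)
  have h3 : Commute (g ^ p ^ k) x := by
    have := Subgroup.pow_index_mem (Subgroup.centralizer {x}) g
    rw [show (Subgroup.centralizer {x}).index = p ^ k from hk] at this
    exact mem_centralizer_singleton_iff_commute.1 this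
  rw [h3.eq, mul_inv_cancel_right] at h2
  have h4 : (x⁻¹ * (g * x * g⁻¹)) ^ p ^ k = 1 := by
    simpa using h2.symm
  have h5 := eq_one_of_pow_eq_one_of_coprime (m := p ^ k) (n := Nat.card N)
    (Nat.Coprime.pow_left _ ((Nat.Prime.coprime_iff_not_dvd hp.out).2 hcard)) h4
    (congrArg Subtype.val (pow_card_eq_one' (x := (⟨_, hcomm x g⟩ : N))))
  rw [h5, mul_one] at h1
  exact mul_inv_eq_iff_eq_mul.1 h1

end

section

variable {E X V : Type} [Group E] [Group X] [Finite X] [AddCommGroup V] [Module ℂ V]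
  [FiniteDimensional ℂ V] (φ : E →* X) (σ : Representation ℂ E V)

/-- The dimension of a coinduced representation. -/
theorem finrank_coindV (h : ∀ g, φ g = 1 → σ g = 1) :
    Module.finrank ℂ (Representation.coindV φ σ) = φ.range.index * Module.finrank ℂ V := by
  obtain ⟨T, hT, -⟩ := Subgroup.exists_isComplement_right φ.range 1
  have hσ : ∀ a b, φ a = φ b → σ a = σ b := by
    intro a b hab
    have h1 : σ (b⁻¹ * a) = 1 := h _ (by rw [map_mul, hab, map_inv, inv_mul_cancel])
    have h2 : a = b * (b⁻¹ * a) := by group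
    rw [h2, map_mul, h1, mul_one]
  have hfin : Fintype T := Fintype.ofFinite T
  choose c hc using fun m : φ.range ↦ m.2
  let L : Representation.coindV φ σ →ₗ[ℂ] (T → V) :=
    { toFun := fun f t ↦ f.1 t
      map_add' := fun _ _ ↦ rfl
      map_smul' := fun _ _ ↦ rfl }
  have hdecomp : ∀ x : X, x = φ (c (hT.equiv x).1) * ((hT.equiv x).2 : X) := by
    intro x
    rw [hc]
    exact (hT.equiv_fst_mul_equiv_snd x).symm
  have hL : Function.Bijective L := by
    constructor
    · intro f g hfg
      apply Subtype.ext
      funext x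
      rw [hdecomp x, f.2, g.2]
      exact congrArg _ (congrFun hfg (hT.equiv x).2)
    · intro F
      refine ⟨⟨fun x ↦ σ (c (hT.equiv x).1) (F (hT.equiv x).2), ?_⟩, ?_⟩
      · intro g x
        have h1 := hT.equiv_mul_left ⟨φ g, g, rfl⟩ x
        change σ (c (hT.equiv (φ g * x)).1) (F (hT.equiv (φ g * x)).2) =
          σ g (σ (c (hT.equiv x).1) (F (hT.equiv x).2))
        rw [show hT.equiv (φ g * x) = _ from h1]
        simp only
        rw [← Module.End.mul_apply, ← map_mul]
        congr 1
        apply hσ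
        rw [map_mul, hc, hc]
        rfl
      · funext t
        change σ (c (hT.equiv (t : X)).1) (F (hT.equiv (t : X)).2) = F t
        have h1 : hT.equiv (t : X) = (1, t) := by
          rw [← Equiv.eq_symm_apply]
          exact (one_mul (t : X)).symm
        rw [h1]
        have h2 : σ (c 1) = 1 := h _ (hc 1)
        simp [h2]
  rw [(LinearEquiv.ofBijective L hL).finrank_eq, Module.finrank_pi_fintype, Finset.sum_const,
    Finset.card_univ, ← Nat.card_eq_fintype_card, smul_eq_mul, ← hT.card_right]

omit [Finite X] [FiniteDimensional ℂ V] in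
theorem eq_zero_of_coind_apply_eq (N : Subgroup X) [N.Normal] (ψ : N → E)
    (hψ : ∀ e, φ (ψ e) = e) (h : ∀ v, (∀ e, σ (ψ e) v = v) → v = 0)
    (f : Representation.coindV φ σ) (hf : ∀ e ∈ N, Representation.coind φ σ e f = f) : f = 0 := by
  apply Subtype.ext
  funext x
  apply h
  intro e
  have h1 := congrArg (fun f ↦ f.1 x)
    (hf (x⁻¹ * e * x) (by simpa using Subgroup.Normal.conj_mem inferInstance _ e.2 x⁻¹))
  have h2 : (f : X → V) (x * (x⁻¹ * e * x)) = (f : X → V) x := h1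
  rw [← f.2, hψ, ← h2]
  group

end

section

variable {E V : Type} [Group E] [AddCommGroup V] [Module ℂ V]
  (ρ : Representation ℂ E V)

/-- The twist of a representation by a linear character. -/
def twist (θ : E →* ℂ) : Representation ℂ E V where
  toFun g := θ g • ρ g
  map_one' := by simp
  map_mul' a b := by
    ext v
    simp [smul_smul, mul_comm]

theorem twist_apply (θ : E →* ℂ) (g : E) : twist ρ θ g = θ g • ρ g := rfl

theorem isIrreducible_twist (θ : E →* ℂ) (h : ρ.IsIrreducible) : (twist ρ θ).IsIrreducible := by
  rw [isIrreducible_iff_forall_submodule] at h ⊢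
  refine ⟨h.1, fun U hU ↦ h.2 U fun g v hv ↦ ?_⟩
  have h1 := U.smul_mem (θ g⁻¹) (hU g v hv)
  rwa [twist_apply, LinearMap.smul_apply, smul_smul, ← map_mul, inv_mul_cancel, map_one,
    one_smul] at h1

/-- An irreducible representation of `p'`-dimension can be twisted to be trivial on a normal
`p`-subgroup `K`, if the group is generated by a `p`-subgroup and a perfect subgroup centralising
`K`. -/
theorem exists_representation_forall_apply_eq_one {p : ℕ} [hp : Fact p.Prime] [Finite E]
    [FiniteDimensional ℂ V] (K D N : Subgroup E) [K.Normal]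
    (hK : IsPGroup p K) (hD : IsPGroup p D) (hKN : ∀ k ∈ K, ∀ e ∈ N, Commute k e)
    (hDN : D ⊔ N = ⊤) (hN : ∀ θ : E →* ℂ, ∀ e ∈ N, θ e = 1) (hρ : ρ.IsIrreducible)
    (hd : ¬ p ∣ Module.finrank ℂ V) (hf : ∀ v, (∀ e ∈ N, ρ e v = v) → v = 0) :
    ∃ σ : Representation ℂ E V, (∀ k ∈ K, σ k = 1) ∧
      ∀ v, (∀ e ∈ N, σ e v = v) → v = 0 := by
  let S : Set (Subgroup E) := {L | ∃ σ : Representation ℂ E V, σ.IsIrreducible ∧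
    (∀ v, (∀ e ∈ N, σ e v = v) → v = 0) ∧ L = MonoidHom.ker σ ⊓ K}
  obtain ⟨L, ⟨σ, hσ, hσf, rfl⟩, hmax⟩ : ∃ L, Maximal (· ∈ S) L :=
    Set.Finite.exists_maximal (Set.toFinite S) ⟨_, ρ, hρ, hf, rfl⟩
  refine ⟨σ, fun k hk ↦ ?_, hσf⟩
  by_contra hkσ
  set F := MonoidHom.ker σ ⊓ K with hF
  set π := QuotientGroup.mk' F with hπ
  have hsurj : Function.Surjective π := QuotientGroup.mk'_surjective F
  have hker : ∀ x, π x = 1 ↔ x ∈ F := fun x ↦ QuotientGroup.eq_one_iff x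
  have hKb : (K.map π).Normal := Subgroup.Normal.map inferInstance _ hsurj
  have hKne : K.map π ≠ ⊥ := by
    intro h
    have h1 : π k ∈ K.map π := ⟨k, hk, rfl⟩
    rw [h, Subgroup.mem_bot, hker] at h1
    exact hkσ h1.1
  obtain ⟨_, ⟨z, hz, rfl⟩, hz1, hzD⟩ := exists_ne_one_forall_commute (D.map π) (K.map π)
    (hD.map π) (hK.map π) hKne
  have hzc : ∀ g, σ (g * z) = σ (z * g) := by
    have h1 : (⊤ : Subgroup E) ≤ (Subgroup.centralizer {π z}).comap π := by
      rw [← hDN, sup_le_iff]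
      constructor
      · intro d hd
        exact mem_centralizer_singleton_iff_commute.2 (hzD _ ⟨d, hd, rfl⟩)
      · intro e he
        exact mem_centralizer_singleton_iff_commute.2 ((hKN z hz e he).symm.map π)
    intro g
    have h2 : Commute (π g) (π z) :=
      mem_centralizer_singleton_iff_commute.1 (h1 (Subgroup.mem_top g))
    have h3 : (z * g)⁻¹ * (g * z) ∈ F := by
      rw [← hker, map_mul, map_inv, map_mul, map_mul, h2.eq, inv_mul_cancel]
    have h4 : σ ((z * g)⁻¹ * (g * z)) = 1 := h3.1
    have h5 : g * z = z * g * ((z * g)⁻¹ * (g * z)) := by group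
    rw [h5, map_mul, h4, mul_one]
  obtain ⟨c, hc⟩ := exists_smul_of_commute σ hσ (σ z) (fun g v ↦ by
    rw [← Module.End.mul_apply, ← Module.End.mul_apply, ← map_mul, ← map_mul, hzc])
  have hc' : σ z = c • 1 := LinearMap.ext hc
  obtain ⟨j, hj⟩ := hK.exists_pow_eq_one hz
  have hnt : Nontrivial V := ((isIrreducible_iff_forall_submodule σ).1 hσ).1
  have hcj : c ^ p ^ j = 1 := by
    obtain ⟨v, hv⟩ := exists_ne (0 : V)
    have h1 : σ (z ^ p ^ j) = c ^ p ^ j • 1 := by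
      rw [map_pow, hc', smul_pow, one_pow]
    rw [hj, map_one] at h1
    have h2 := congrArg (fun f ↦ f v) h1
    simp only [LinearMap.smul_apply, Module.End.one_apply] at h2
    by_contra hne
    have h3 : (c ^ p ^ j - 1) • v = 0 := by rw [sub_smul, one_smul, ← h2, sub_self]
    rcases smul_eq_zero.1 h3 with h | h
    · exact hne (sub_eq_zero.1 h)
    · exact hv h
  obtain ⟨m, hm⟩ : ∃ m : ℕ, c * (c ^ Module.finrank ℂ V) ^ m = 1 := by
    have hcop : (p ^ j).Coprime (Module.finrank ℂ V) :=
      Nat.Coprime.pow_left _ ((Nat.Prime.coprime_iff_not_dvd hp.out).2 hd)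
    obtain ⟨m, hm⟩ := exists_pow_eq_self_of_coprime (x := c)
      (hcop.symm.coprime_dvd_right (orderOf_dvd_of_pow_eq_one hcj))
    have hpos : 0 < p ^ j := pow_pos hp.out.pos j
    refine ⟨m * (p ^ j - 1), ?_⟩
    rw [pow_mul, hm, ← pow_succ', Nat.sub_add_cancel hpos, hcj]
  let θ : E →* ℂ := (powMonoidHom m).comp (LinearMap.det.comp σ)
  have hθ : ∀ g, θ g = (LinearMap.det (σ g)) ^ m := fun g ↦ rfl
  have hmem : MonoidHom.ker (twist σ θ) ⊓ K ∈ S := by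
    refine ⟨twist σ θ, isIrreducible_twist σ θ hσ, fun v hv ↦ hσf v fun e he ↦ ?_, rfl⟩
    have := hv e he
    rwa [twist_apply, hN θ e he, one_smul] at this
  have hle : F ≤ MonoidHom.ker (twist σ θ) ⊓ K := by
    rintro x ⟨hx, hxK⟩
    refine ⟨?_, hxK⟩
    have hx' : σ x = 1 := hx
    change twist σ θ x = 1
    rw [twist_apply, hθ, hx', map_one, one_pow, one_smul]
  have hzm : z ∈ MonoidHom.ker (twist σ θ) ⊓ K := by
    refine ⟨?_, hz⟩
    change twist σ θ z = 1
    rw [twist_apply, hθ, hc', LinearMap.det_smul, map_one, mul_one, smul_smul, mul_comm, hm,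
      one_smul]
  exact hz1 ((hker z).2 (hmax hmem hle hzm))

end

section

variable {X : Type} [Group X] (N P : Subgroup X) [N.Normal]

/-- The pairs `(a, b)` with `b ∈ P` and `aN = bN`. -/
def pairSubgroup : Subgroup (X × P) :=
  MonoidHom.eqLocus ((QuotientGroup.mk' N).comp (MonoidHom.fst X P))
    (((QuotientGroup.mk' N).comp P.subtype).comp (MonoidHom.snd X P))

variable {N P}

theorem mem_pairSubgroup {q : X × P} : q ∈ pairSubgroup N P ↔ q.1⁻¹ * q.2 ∈ N :=
  QuotientGroup.eq

theorem inv_mul_mul_mem (q : pairSubgroup N P) (n : N) : q.1.1⁻¹ * n * q.1.2 ∈ N := by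
  have h1 := mem_pairSubgroup.1 q.2
  have h2 := Subgroup.Normal.conj_mem inferInstance _ n.2 q.1.1⁻¹
  have h3 : q.1.1⁻¹ * n * q.1.2 = (q.1.1⁻¹ * n * q.1.1⁻¹⁻¹) * (q.1.1⁻¹ * q.1.2) := by group
  rw [h3]
  exact mul_mem h2 h1

/-- The action of pairs on the functions on `N` induced by `n ↦ a * n * b⁻¹`. -/
def pairRep : Representation ℂ (pairSubgroup N P) (N → ℂ) where
  toFun q :=
    { toFun := fun f n ↦ f ⟨q.1.1⁻¹ * n * q.1.2, inv_mul_mul_mem q n⟩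
      map_add' := fun _ _ ↦ rfl
      map_smul' := fun _ _ ↦ rfl }
  map_one' := by
    ext f n
    simp
  map_mul' q r := by
    refine LinearMap.ext fun f ↦ funext fun n ↦ congrArg f (Subtype.ext ?_)
    simp [mul_assoc]

variable [Finite X]

theorem sum_pairRep [Fintype N] (q : pairSubgroup N P) (f : N → ℂ) :
    ∑ n, pairRep q f n = ∑ n, f n := by
  have h : Function.Injective
      (fun n : N ↦ (⟨q.1.1⁻¹ * n * q.1.2, inv_mul_mul_mem q n⟩ : N)) := by
    intro m n hmn
    have h1 := congrArg Subtype.val hmn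
    exact Subtype.ext (mul_left_cancel (mul_right_cancel h1))
  exact (Finite.injective_iff_bijective.1 h).sum_comp f

/-- The subrepresentation of functions with sum zero. -/
def pairRepAug [Fintype N] :
    Representation ℂ (pairSubgroup N P) (LinearMap.ker (∑ n : N, LinearMap.proj (R := ℂ)
      (φ := fun _ : N ↦ ℂ) n)) where
  toFun q := (pairRep q).restrict (fun f hf ↦ by
    rw [LinearMap.mem_ker] at hf ⊢
    rw [← hf]
    simpa using sum_pairRep q f)
  map_one' := by
    ext f n
    simp
  map_mul' q r := by
    refine LinearMap.ext fun f ↦ Subtype.ext ?_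
    change pairRep (q * r) f.1 = pairRep q (pairRep r f.1)
    rw [map_mul]
    rfl

omit [N.Normal] in
theorem finrank_pairRepAug [Fintype N] :
    Module.finrank ℂ (LinearMap.ker (∑ n : N, LinearMap.proj (R := ℂ)
      (φ := fun _ : N ↦ ℂ) n)) + 1 = Nat.card N := by
  have h := LinearMap.finrank_range_add_finrank_ker (∑ n : N, LinearMap.proj (R := ℂ)
      (φ := fun _ : N ↦ ℂ) n)
  have h1 : LinearMap.range (∑ n : N, LinearMap.proj (R := ℂ) (φ := fun _ : N ↦ ℂ) n) = ⊤ := by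
    rw [LinearMap.range_eq_top]
    intro c
    refine ⟨Pi.single 1 c, ?_⟩
    simp
  rw [h1, finrank_top, Module.finrank_self, Module.finrank_fintype_fun_eq_card,
    ← Nat.card_eq_fintype_card] at h
  omega

/-- If `p` divides the order of a perfect normal subgroup, then some irreducible representation
of dimension prime to `p` is nontrivial on it. -/
theorem exists_irreducible_apply_ne_one_of_dvd_card {p : ℕ} [hp : Fact p.Prime]
    (N : Subgroup X) [N.Normal] (hN : commutator N = ⊤) (hdvd : p ∣ Nat.card N) :
    ∃ (V : Type) (_ : AddCommGroup V) (_ : Module ℂ V) (_ : FiniteDimensional ℂ V)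
      (ρ : Representation ℂ X V), ρ.IsIrreducible ∧ ¬ p ∣ Module.finrank ℂ V ∧
        ∃ e ∈ N, ρ e ≠ 1 := by
  have hfin : Fintype N := Fintype.ofFinite N
  let P : Sylow p X := default
  have hP : IsPGroup p (P : Subgroup X) := P.isPGroup'
  let φ : pairSubgroup N (P : Subgroup X) →* X :=
    (MonoidHom.fst X (P : Subgroup X)).comp (Subgroup.subtype _)
  let ψ : N →* pairSubgroup N (P : Subgroup X) :=
    { toFun := fun e ↦ ⟨((e : X), 1), mem_pairSubgroup.2 (by simp)⟩
      map_one' := rfl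
      map_mul' := fun a b ↦ Subtype.ext (Prod.ext rfl (one_mul _).symm) }
  let δ : (P : Subgroup X) →* pairSubgroup N (P : Subgroup X) :=
    { toFun := fun b ↦ ⟨((b : X), b), mem_pairSubgroup.2 (by simp)⟩
      map_one' := rfl
      map_mul' := fun a b ↦ rfl }
  have hdim : ¬ p ∣ Module.finrank ℂ (LinearMap.ker (∑ n : N, LinearMap.proj (R := ℂ)
      (φ := fun _ : N ↦ ℂ) n)) := by
    intro h
    rw [← finrank_pairRepAug] at hdvd
    exact hp.out.one_lt.ne' (Nat.dvd_one.1 ((Nat.dvd_add_right h).1 hdvd))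
  have hfix : ∀ v : LinearMap.ker (∑ n : N, LinearMap.proj (R := ℂ) (φ := fun _ : N ↦ ℂ) n),
      (∀ e ∈ ψ.range, pairRepAug e v = v) → v = 0 := by
    intro v hv
    have h1 : ∀ n : N, v.1 n = v.1 1 := by
      intro n
      have h2 := congrFun (congrArg Subtype.val (hv (ψ n) ⟨n, rfl⟩)) n
      rw [← h2]
      refine congrArg v.1 (Subtype.ext ?_)
      change (n : X)⁻¹ * n * ((1 : (P : Subgroup X)) : X) = 1
      simp
    have h3 : ∑ n : N, v.1 n = 0 := by
      have h2 := LinearMap.mem_ker.1 v.2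
      rwa [LinearMap.sum_apply] at h2
    simp only [h1, Finset.sum_const, Finset.card_univ, nsmul_eq_mul, mul_eq_zero,
      Nat.cast_eq_zero, Fintype.card_ne_zero, false_or] at h3
    apply Subtype.ext
    funext n
    rw [h1, h3]
    rfl
  obtain ⟨Z, _, _, _, ρ, hρ, hρd, hρf, -⟩ := exists_irreducible_of_not_dvd_finrank
    pairRepAug p ψ.range hdim hfix
  have hKp : IsPGroup p φ.ker := by
    rw [isPGroup_iff_pow_pow_eq_one]
    rintro ⟨q, hq⟩
    obtain ⟨k, hk⟩ := isPGroup_iff_pow_pow_eq_one.1 hP q.1.2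
    have hq1 : q.1.1 = 1 := hq
    refine ⟨k, Subtype.ext (Subtype.ext (Prod.ext ?_ hk))⟩
    change q.1.1 ^ p ^ k = 1
    rw [hq1, one_pow]
  have hDp : IsPGroup p δ.range := by
    rw [isPGroup_iff_pow_pow_eq_one]
    rintro ⟨_, b, rfl⟩
    obtain ⟨k, hk⟩ := isPGroup_iff_pow_pow_eq_one.1 hP b
    refine ⟨k, Subtype.ext ?_⟩
    change (δ b) ^ p ^ k = 1
    rw [← map_pow, hk, map_one]
  have hcomm : ∀ k ∈ φ.ker, ∀ e ∈ ψ.range, Commute k e := by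
    rintro k hk _ ⟨e, rfl⟩
    have hk1 : k.1.1 = 1 := hk
    refine Subtype.ext (Prod.ext ?_ ?_)
    · change k.1.1 * e = e * k.1.1
      rw [hk1, one_mul, mul_one]
    · change k.1.2 * 1 = 1 * k.1.2
      rw [one_mul, mul_one]
  have htop : δ.range ⊔ ψ.range = ⊤ := by
    rw [eq_top_iff]
    intro q _
    have h1 : (q.1.2 : X)⁻¹ * q.1.1 ∈ N := by
      have := inv_mem (mem_pairSubgroup.1 q.2)
      rwa [mul_inv_rev, inv_inv] at this
    have h2 : q = δ q.1.2 * ψ ⟨_, h1⟩ := by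
      refine Subtype.ext (Prod.ext ?_ (mul_one _).symm)
      exact (mul_inv_cancel_left _ _).symm
    rw [h2]
    exact mul_mem (Subgroup.mem_sup_left ⟨_, rfl⟩) (Subgroup.mem_sup_right ⟨_, rfl⟩)
  have hperf : ∀ θ : pairSubgroup N (P : Subgroup X) →* ℂ, ∀ e ∈ ψ.range, θ e = 1 := by
    rintro θ _ ⟨e, rfl⟩
    have h1 : e ∈ MonoidHom.ker (θ.comp ψ).toHomUnits :=
      Abelianization.commutator_subset_ker _ (by rw [hN]; trivial)
    have h2 := congrArg Units.val (MonoidHom.mem_ker.1 h1)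
    simpa using h2
  obtain ⟨σ, hσK, hσf⟩ := exists_representation_forall_apply_eq_one ρ φ.ker δ.range ψ.range
    hKp hDp hcomm htop hperf hρ hρd hρf
  have hPr : (P : Subgroup X) ≤ φ.range := fun b hb ↦ ⟨δ ⟨b, hb⟩, rfl⟩
  have hind : ¬ p ∣ Module.finrank ℂ (Representation.coindV φ σ) := by
    rw [finrank_coindV φ σ fun g hg ↦ hσK g hg, hp.out.dvd_mul]
    rintro (h | h)
    · exact P.not_dvd_index (h.trans (Subgroup.index_dvd_of_le hPr))
    · exact hρd h
  obtain ⟨V, _, _, _, τ, hτ, hτd, hτf, -⟩ := exists_irreducible_of_not_dvd_finrank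
    (Representation.coind φ σ) p N hind (eq_zero_of_coind_apply_eq φ σ N ψ (fun e ↦ rfl)
      fun v hv ↦ hσf v (by rintro _ ⟨e, rfl⟩; exact hv e))
  refine ⟨V, _, _, inferInstance, τ, hτ, hτd, ?_⟩
  by_contra hcon
  push Not at hcon
  have hnt : Nontrivial V := ((isIrreducible_iff_forall_submodule τ).1 hτ).1
  obtain ⟨v, hv⟩ := exists_ne (0 : V)
  exact hv (hτf v fun e he ↦ by rw [hcon e he]; rfl)

end

theorem isIntegral_character {G V : Type} [Group G] [Finite G] [AddCommGroup V] [Module ℂ V]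
    [FiniteDimensional ℂ V] (ρ : Representation ℂ G V) (g : G) :
    IsIntegral ℤ (ρ.character g) := by
  obtain ⟨ι, _, b, l, hb, hl⟩ := exists_eigenbasis ρ g
  rw [character_eq_sum_of_basis ρ b l g hb]
  exact IsIntegral.sum _ fun i _ ↦ IsIntegral.of_pow Nat.card_pos (by rw [hl]; exact isIntegral_one)

theorem sum_character_eq_zero {G V : Type} [Group G] [Fintype G] [AddCommGroup V] [Module ℂ V]
    [FiniteDimensional ℂ V] (ρ : Representation ℂ G V) (h : ρ.IsIrreducible)
    (hρ : ∃ g, ρ g ≠ 1) : ∑ g, ρ.character g = 0 := by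
  have h1 : ∀ v, ∀ g, ρ g ((∑ x, ρ x) v) = (∑ x, ρ x) v := by
    intro v g
    rw [LinearMap.sum_apply, map_sum]
    exact Fintype.sum_equiv (Equiv.mulLeft g) _ _ fun x ↦ by
      rw [Equiv.coe_mulLeft, map_mul, Module.End.mul_apply]
  have h2 : ∑ x, ρ x = 0 := by
    rcases ((isIrreducible_iff_forall_submodule ρ).1 h).2 ρ.invariants
      (fun g v hv ↦ by rwa [hv g]) with h3 | h3
    · ext v
      have h4 : (∑ x, ρ x) v ∈ ρ.invariants := h1 v
      rwa [h3, Submodule.mem_bot] at h4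
    · obtain ⟨g, hg⟩ := hρ
      refine absurd (LinearMap.ext fun v ↦ ?_) hg
      have h4 : v ∈ ρ.invariants := h3 ▸ Submodule.mem_top
      exact h4 g
  simp_rw [Representation.character]
  rw [← map_sum, h2, map_zero]

/-- A perfect finite group without proper nontrivial normal subgroups has no conjugacy class
whose size is a nontrivial power of a prime. -/
theorem eq_one_of_classSize_dvd_pow {p : ℕ} (hp : p.Prime) {Q : Type} [Group Q] [Finite Q]
    (hQ : ∀ K : Subgroup Q, K.Normal → K = ⊥ ∨ K = ⊤) (hperf : commutator Q = ⊤) {y : Q} {k : ℕ}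
    (hy : classSize y ∣ p ^ k) : y = 1 := by
  by_contra hy1
  have : Fintype Q := Fintype.ofFinite Q
  obtain ⟨n, d, ρ, hirr, hsum⟩ := exists_irreducible_family Q
  have hs : ∀ h : Q,
      ∑ i, (d i : ℂ) * (ρ i).character h = if h = 1 then (Nat.card Q : ℂ) else 0 := by
    intro h
    have h1 := hsum 1 h
    simp only [Representation.char_one, Module.finrank_fin_fun] at h1
    rw [h1]
    split_ifs with h2
    · simp [h2, Nat.card_eq_fintype_card]
    · simp [h2]
  let T : Finset (Fin n) := Finset.univ.filter fun i ↦ ∀ g, ρ i g = 1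
  have hT : ∀ i ∈ T, ∀ g, (ρ i).character g = d i := by
    intro i hi g
    rw [Representation.character, (Finset.mem_filter.1 hi).2 g]
    simp
  have hTc : ∀ i ∈ Finset.univ.filter (fun i ↦ ¬ ∀ g, ρ i g = 1), ∑ g, (ρ i).character g = 0 := by
    intro i hi
    refine sum_character_eq_zero (ρ i) (hirr i) ?_
    have := (Finset.mem_filter.1 hi).2
    push Not at this
    exact this
  have hT1 : ∑ i ∈ T, (d i : ℂ) * d i = 1 := by
    have h1 : ∑ h : Q, ∑ i, (d i : ℂ) * (ρ i).character h = Nat.card Q := by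
      simp [hs]
    rw [Finset.sum_comm] at h1
    simp_rw [← Finset.mul_sum] at h1
    rw [← Finset.sum_filter_add_sum_filter_not _ (fun i ↦ ∀ g, ρ i g = 1),
      Finset.sum_congr rfl fun i hi ↦ congrArg ((d i : ℂ) * ·)
        (Finset.sum_congr rfl fun g _ ↦ hT i hi g),
      Finset.sum_congr rfl fun i hi ↦ congrArg ((d i : ℂ) * ·) (hTc i hi)] at h1
    simp only [Finset.sum_const, Finset.card_univ, nsmul_eq_mul, mul_zero,
      add_zero, ← Nat.card_eq_fintype_card] at h1
    have h0 : (Nat.card Q : ℂ) ≠ 0 := Nat.cast_ne_zero.2 Nat.card_pos.ne'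
    apply mul_left_cancel₀ h0
    rw [Finset.mul_sum, mul_one]
    refine Eq.trans (Finset.sum_congr rfl fun i _ ↦ ?_) h1
    ring
  have h1 := hs y
  rw [if_neg hy1, ← Finset.sum_filter_add_sum_filter_not _ (fun i ↦ ∀ g, ρ i g = 1),
    Finset.sum_congr rfl fun i hi ↦ congrArg ((d i : ℂ) * ·) (hT i hi y), hT1] at h1
  obtain ⟨i, hi, hpi, hi0⟩ : ∃ i, (¬ ∀ g, ρ i g = 1) ∧ ¬ p ∣ d i ∧ (ρ i).character y ≠ 0 := by
    by_contra hcon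
    push Not at hcon
    have h2 : ∀ i ∈ Finset.univ.filter (fun i ↦ ¬ ∀ g, ρ i g = 1),
        (d i : ℂ) * (ρ i).character y = p * (((d i / p : ℕ) : ℂ) * (ρ i).character y) := by
      intro i hi
      by_cases hpi : p ∣ d i
      · obtain ⟨m, hm⟩ := hpi
        have h3 : (d i : ℂ) = p * (d i / p : ℕ) := by
          rw [← Nat.cast_mul, hm, Nat.mul_div_cancel_left _ hp.pos]
        rw [← mul_assoc, ← h3]
      · rw [hcon i (by simpa using (Finset.mem_filter.1 hi).2) hpi]
        simp
    rw [Finset.sum_congr rfl h2, ← Finset.mul_sum] at h1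
    have h_int : IsIntegral ℤ (∑ i ∈ Finset.univ.filter (fun i ↦ ¬ ∀ g, ρ i g = 1),
        ((d i / p : ℕ) : ℂ) * (ρ i).character y) := by
      refine IsIntegral.sum _ fun i _ ↦ IsIntegral.mul ?_ (isIntegral_character _ _)
      exact map_natCast (algebraMap ℤ ℂ) (d i / p) ▸ isIntegral_algebraMap
    have hp0 : (p : ℂ) ≠ 0 := Nat.cast_ne_zero.2 hp.ne_zero
    have h3 : ∑ i ∈ Finset.univ.filter (fun i ↦ ¬ ∀ g, ρ i g = 1),
        ((d i / p : ℕ) : ℂ) * (ρ i).character y = algebraMap ℚ ℂ (-1 / p) := by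
      rw [map_div₀, map_neg, map_one, map_natCast, eq_div_iff hp0]
      linear_combination h1
    rw [h3, isIntegral_algebraMap_iff (algebraMap ℚ ℂ).injective] at h_int
    obtain ⟨m, hm⟩ := IsIntegrallyClosed.isIntegral_iff.1 h_int
    have hpq : (p : ℚ) ≠ 0 := Nat.cast_ne_zero.2 hp.ne_zero
    have h4 : (m : ℚ) * p = -1 := by
      rw [eq_div_iff hpq] at hm
      simpa using hm
    have h5 : m * p = -1 := by exact_mod_cast h4
    have h6 : (p : ℤ) ∣ 1 := ⟨-m, by linear_combination h5⟩
    exact hp.one_lt.ne' (Nat.dvd_one.1 (by exact_mod_cast h6))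
  have hcop : (classSize y).Coprime (Module.finrank ℂ (Fin (d i) → ℂ)) := by
    rw [Module.finrank_fin_fun]
    exact Nat.Coprime.coprime_dvd_left hy
      (Nat.Coprime.pow_left _ ((Nat.Prime.coprime_iff_not_dvd hp).2 hpi))
  obtain ⟨c, hc⟩ := (character_eq_zero_or_exists_smul (ρ i) (hirr i) y hcop).resolve_left hi0
  have hker : ∀ z, ρ i z = 1 → z = 1 := by
    intro z hz
    rcases hQ (MonoidHom.ker (ρ i)) inferInstance with h2 | h2
    · rw [← Subgroup.mem_bot, ← h2]
      exact hz
    · refine absurd (fun g ↦ ?_) hi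
      have : g ∈ MonoidHom.ker (ρ i) := h2 ▸ Subgroup.mem_top g
      exact this
  have hyc : y ∈ Subgroup.center Q := by
    rw [Subgroup.mem_center_iff]
    intro g
    refine mul_inv_eq_one.1 (hker _ ?_)
    have h2 : ρ i (g * y) = ρ i (y * g) := by
      refine LinearMap.ext fun v ↦ ?_
      simp [hc]
    rw [map_mul, h2, ← map_mul, mul_inv_cancel, map_one]
  rcases hQ (Subgroup.center Q) inferInstance with h2 | h2
  · rw [h2, Subgroup.mem_bot] at hyc
    exact hy1 hyc
  · have h3 : commutator Q = ⊥ := by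
      rw [eq_bot_iff, commutator_def, Subgroup.commutator_le]
      intro a _ b _
      have : b ∈ Subgroup.center Q := h2 ▸ Subgroup.mem_top b
      rw [Subgroup.mem_bot, commutatorElement_eq_one_iff_mul_comm]
      exact Subgroup.mem_center_iff.1 this a
    rw [hperf] at h3
    have h4 : y ∈ (⊤ : Subgroup Q) := Subgroup.mem_top y
    rw [h3, Subgroup.mem_bot] at h4
    exact hy1 h4

section

variable {X : Type} [Group X] [Finite X] {N : Subgroup X} [N.Normal]

/-- A perfect minimal normal subgroup has no nontrivial element whose class in it has prime power
size. -/
theorem eq_one_of_classSize_subtype_dvd_pow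
    (hmin : ∀ K : Subgroup X, K.Normal → K ≠ ⊥ → N ≤ K) (hperf : commutator N = ⊤)
    {q : ℕ} (hq : q.Prime) {y : N} {k : ℕ} (hy : classSize y ∣ q ^ k) : y = 1 := by
  by_contra hy1
  have hbt : (⊥ : Subgroup N) ≠ ⊤ := fun h ↦ hy1 (by
    rw [← Subgroup.mem_bot, h]
    exact Subgroup.mem_top y)
  obtain ⟨M, -, ⟨hMn, hMt⟩, hmax⟩ := Finite.exists_le_maximal
    (p := fun M : Subgroup N ↦ M.Normal ∧ M ≠ ⊤) (a := ⊥) ⟨inferInstance, hbt⟩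
  obtain ⟨c, hc⟩ : ∃ c : X, MulAut.conjNormal c y ∉ M := by
    by_contra hcon
    push Not at hcon
    have h1 : Subgroup.normalClosure {(y : X)} ≤ M.map N.subtype := by
      rw [Subgroup.normalClosure, Subgroup.closure_le]
      intro z hz
      obtain ⟨_, rfl, hz⟩ := Group.mem_conjugatesOfSet_iff.1 hz
      obtain ⟨c, rfl⟩ := isConj_iff.1 hz
      exact ⟨_, hcon c, MulAut.conjNormal_apply c y⟩
    have h2 := hmin _ (Subgroup.normalClosure_normal (s := {(y : X)})) (fun h ↦ hy1 (by
      have : (y : X) ∈ Subgroup.normalClosure {(y : X)} := Subgroup.subset_normalClosure rfl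
      rw [h, Subgroup.mem_bot] at this
      exact Subtype.ext this))
    apply hMt
    rw [eq_top_iff]
    intro e _
    obtain ⟨e', he', h3⟩ := h1 (h2 e.2)
    rwa [← Subtype.ext h3]
  let f : N →* N ⧸ M := (QuotientGroup.mk' M).comp (MulAut.conjNormal c : N ≃* N).toMonoidHom
  have hf : Function.Surjective f :=
    (QuotientGroup.mk'_surjective M).comp (MulAut.conjNormal c : N ≃* N).surjective
  have hfy : f y ≠ 1 := fun h ↦ hc ((QuotientGroup.eq_one_iff _).1 h)
  refine hfy (eq_one_of_classSize_dvd_pow hq ?_ ?_ ((classSize_map_dvd f hf y).trans hy))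
  · intro K hK
    by_cases hKt : K.comap (QuotientGroup.mk' M) = ⊤
    · right
      rw [← Subgroup.map_comap_eq_self_of_surjective (QuotientGroup.mk'_surjective M) K, hKt,
        ← MonoidHom.range_eq_map, MonoidHom.range_eq_top]
      exact QuotientGroup.mk'_surjective M
    · left
      have h1 : K.comap (QuotientGroup.mk' M) ≤ M :=
        hmax ⟨inferInstance, hKt⟩ (QuotientGroup.le_comap_mk' M K)
      rw [eq_bot_iff]
      intro z hz
      obtain ⟨e, rfl⟩ := QuotientGroup.mk'_surjective M z
      rw [Subgroup.mem_bot]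
      exact (QuotientGroup.eq_one_iff _).2 (h1 hz)
  · rw [commutator_def, ← Subgroup.map_top_of_surjective _ (QuotientGroup.mk'_surjective M),
      ← Subgroup.map_commutator, ← commutator_def, hperf]

omit [Finite X] in
theorem centralizer_eq_bot_of_not_commute (hmin : ∀ K : Subgroup X, K.Normal → K ≠ ⊥ → N ≤ K)
    (hab : ∃ a ∈ N, ∃ b ∈ N, ¬ Commute a b) : Subgroup.centralizer (N : Set X) = ⊥ := by
  by_contra h
  obtain ⟨a, ha, b, hb, hab⟩ := hab
  exact hab (hmin _ inferInstance h hb a ha)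

omit [Finite X] in
theorem commutator_eq_top_of_not_commute (hmin : ∀ K : Subgroup X, K.Normal → K ≠ ⊥ → N ≤ K)
    (hab : ∃ a ∈ N, ∃ b ∈ N, ¬ Commute a b) : commutator N = ⊤ := by
  obtain ⟨a, ha, b, hb, hab⟩ := hab
  have h1 : (commutator N).map N.subtype = ⁅N, N⁆ := by
    rw [commutator_def, Subgroup.map_commutator, ← MonoidHom.range_eq_map, N.range_subtype]
  have h2 : N ≤ (commutator N).map N.subtype := by
    rw [h1]
    refine hmin _ inferInstance fun h ↦ hab ?_
    have h3 := Subgroup.commutator_mem_commutator ha hb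
    rw [h, Subgroup.mem_bot, commutatorElement_eq_one_iff_mul_comm] at h3
    exact h3
  rw [eq_top_iff]
  intro e _
  obtain ⟨e', he', h3⟩ := h2 e.2
  rwa [← Subtype.ext h3]

theorem dvd_card_of_not_commute {p : ℕ} [hp : Fact p.Prime]
    (hmin : ∀ K : Subgroup X, K.Normal → K ≠ ⊥ → N ≤ K)
    (hab : ∃ a ∈ N, ∃ b ∈ N, ¬ Commute a b)
    (hv : ∀ g, IsVanishing X g → ∃ k, classSize g = p ^ k) : p ∣ Nat.card N := by
  by_contra hcard
  have hcen := centralizer_eq_bot_of_not_commute hmin hab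
  obtain ⟨a, ha, b, hb, hab⟩ := hab
  have ha1 : a ≠ 1 := by
    rintro rfl
    exact hab (Commute.one_left b)
  obtain ⟨V, _, _, _, ρ, hρ, hρa⟩ := exists_irreducible_apply_ne_one ha1
  have hdim : 1 < Module.finrank ℂ V := by
    by_contra hd
    push Not at hd
    refine hab (mul_inv_eq_one.1 (eq_one_of_apply_eq_one hmin ρ ⟨a, ha, hρa⟩ ?_))
    rw [map_mul, commute_of_finrank_le_one ρ hd, ← map_mul, mul_inv_cancel, map_one]
  obtain ⟨x, hx⟩ := exists_character_eq_zero ρ hρ hdim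
  have hxv := IsVanishing.of_isIrreducible ρ hρ hx
  have h1 := mem_centralizer_of_isVanishing hcard hv x hxv
  rw [hcen, Subgroup.mem_bot] at h1
  exact not_isVanishing_of_mem_center (h1 ▸ one_mem _) hxv

end

section

variable {p : ℕ} [hp : Fact p.Prime] {X : Type} [Group X] [Finite X] {N : Subgroup X} [N.Normal]

theorem exists_isVanishing_orderOf_prime
    (hmin : ∀ K : Subgroup X, K.Normal → K ≠ ⊥ → N ≤ K) (hab : ∃ a ∈ N, ∃ b ∈ N, ¬ Commute a b)
    (hv : ∀ g, IsVanishing X g → ∃ k, classSize g = p ^ k) :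
    ∃ (r : ℕ) (x : X), r.Prime ∧ orderOf x = r ∧ IsVanishing X x := by
  have hcen := centralizer_eq_bot_of_not_commute hmin hab
  obtain ⟨V, _, _, _, ρ, hρ, hρd, hρN⟩ := exists_irreducible_apply_ne_one_of_dvd_card N
    (commutator_eq_top_of_not_commute hmin hab) (dvd_card_of_not_commute hmin hab hv)
  have hfaith : ∀ g, ρ g = 1 → g = 1 := fun g ↦ eq_one_of_apply_eq_one hmin ρ hρN
  have hdim : 1 < Module.finrank ℂ V := by
    by_contra hd
    push Not at hd
    obtain ⟨a, ha, b, hb, hab⟩ := hab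
    refine hab (mul_inv_eq_one.1 (hfaith _ ?_))
    rw [map_mul, commute_of_finrank_le_one ρ hd, ← map_mul, mul_inv_cancel, map_one]
  obtain ⟨g, hg⟩ := exists_character_eq_zero ρ hρ hdim
  have hgv := IsVanishing.of_isIrreducible ρ hρ hg
  have hg1 : g ≠ 1 := by
    rintro rfl
    exact not_isVanishing_of_mem_center (one_mem _) hgv
  obtain ⟨k, hk⟩ := hv g hgv
  obtain ⟨r, hr, hrg⟩ := Nat.exists_prime_and_dvd (orderOf_eq_one_iff.not.2 hg1)
  have hx := orderOf_pow_orderOf_div (orderOf_pos g).ne' hrg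
  refine ⟨r, _, hr, hx, IsVanishing.of_isIrreducible ρ hρ ?_⟩
  set x := g ^ (orderOf g / r)
  have hxk : classSize x ∣ p ^ k := by
    rw [← hk]
    refine Subgroup.index_dvd_of_le fun c hc ↦ ?_
    rw [mem_centralizer_singleton_iff_commute] at hc ⊢
    exact hc.pow_right _
  refine (character_eq_zero_or_exists_smul ρ hρ x (Nat.Coprime.coprime_dvd_left hxk
    (Nat.Coprime.pow_left _ ((Nat.Prime.coprime_iff_not_dvd hp.out).2 hρd)))).resolve_right ?_
  rintro ⟨c, hc⟩
  have hxc : x ∈ Subgroup.centralizer (N : Set X) := by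
    intro e _
    refine mul_inv_eq_one.1 (hfaith _ ?_)
    have h2 : ρ (e * x) = ρ (x * e) := by
      refine LinearMap.ext fun v ↦ ?_
      simp [hc]
    rw [map_mul, h2, ← map_mul, mul_inv_cancel, map_one]
  rw [hcen, Subgroup.mem_bot] at hxc
  rw [hxc, orderOf_one] at hx
  exact hr.one_lt.ne hx

omit [Finite X] in
theorem exists_pow_map_eq {G : Type} [Group G] [Finite G] (f : G →* X) {r : ℕ} (hr : r.Prime)
    {g : G} (hg : f g ^ r = 1) : ∃ a k : ℕ, f (g ^ a) = f g ∧ (g ^ a) ^ r ^ k = 1 := by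
  obtain ⟨a, b, hab, ⟨k, hk⟩, hb⟩ := exists_pow_mul_pow_eq r hr g
  refine ⟨a, k, ?_, hk⟩
  have h1 : f (g ^ b) = 1 := by
    refine eq_one_of_pow_eq_one_of_coprime hb ?_ (n := orderOf (g ^ b)) ?_
    · rw [map_pow, ← pow_mul, mul_comm, pow_mul, hg, one_pow]
    · rw [← map_pow, pow_orderOf_eq_one, map_one]
  have h2 := congrArg f hab
  rwa [map_mul, h1, mul_one] at h2

theorem false_of_isVanishing_orderOf_prime {G : Type} [Group G] [Finite G] {n : ℕ}
    (hG : ∀ g : G, IsVanishing G g → classSize g = p ^ n) (f : G →* X)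
    (hf : Function.Surjective f)
    (hmin : ∀ K : Subgroup X, K.Normal → K ≠ ⊥ → N ≤ K) (hNp : ¬ IsPGroup p N)
    (hperf : commutator N = ⊤) {r : ℕ} {x : X} (hr : r.Prime) (hx : orderOf x = r)
    (hxv : IsVanishing X x) : False := by
  obtain ⟨g, rfl⟩ := hf x
  obtain ⟨x, k, hfx, hak⟩ : ∃ (x : G) (k : ℕ), f x = f g ∧ x ^ r ^ k = 1 := by
    obtain ⟨a, k, h1, h2⟩ := exists_pow_map_eq f hr (hx ▸ pow_orderOf_eq_one (f g))
    exact ⟨_, k, h1, h2⟩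
  have hxv' : IsVanishing G x := IsVanishing.of_surjective f hf (hfx ▸ hxv)
  have hcx := hG x hxv'
  have hle := classSize_le_of_forall_isVanishing (p ^ n) hG ⟨x, hxv'⟩
  have key : ∀ (s l : ℕ) (y : G), s.Prime → s ≠ r → y ^ s ^ l = 1 → Commute x y → f y ∈ N →
      f y = 1 := by
    intro s l y hs hsr hy hxy hyN
    have hcop : (orderOf x).Coprime (orderOf y) :=
      (((Nat.coprime_primes hr hs).2 hsr.symm).pow k l).coprime_dvd_left
        (orderOf_dvd_of_pow_eq_one hak) |>.coprime_dvd_right (orderOf_dvd_of_pow_eq_one hy)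
    have h1 : classSize y ∣ p ^ n := by
      rw [← hcx]
      have h2 : classSize (x * y) ≤ classSize x := (hle (x * y)).trans_eq hcx.symm
      have h3 := centralizer_le_of_classSize_mul_le hxy hcop h2
      exact Subgroup.index_dvd_of_le h3
    have h2 : classSize (⟨f y, hyN⟩ : N) ∣ classSize (f y) := classSize_subtype_dvd N ⟨f y, hyN⟩
    have h3 := (h2.trans (classSize_map_dvd f hf y)).trans h1
    exact congrArg Subtype.val (eq_one_of_classSize_subtype_dvd_pow hmin hperf hp.out h3)
  have hprimes : ∀ s, s.Prime → s ∣ Nat.card N → s = p ∨ s = r := by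
    intro s hs hsN
    by_contra hcon
    push Not at hcon
    have := Fact.mk hs
    let E : Subgroup N := ((Subgroup.centralizer {x}).subgroupOf (N.comap f)).map
      (f.subgroupComap N)
    have hE : E.index ∣ p ^ n := by
      refine (Subgroup.index_map_dvd _ (f.subgroupComap_surjective_of_surjective N hf)).trans ?_
      rw [← hcx]
      exact relIndex_centralizer_dvd_classSize (N.comap f) x
    have hsE : s ∣ Nat.card E := by
      rw [← E.card_mul_index] at hsN
      refine (hs.dvd_mul.1 hsN).resolve_right fun h ↦ hcon.1 ?_
      exact (Nat.prime_dvd_prime_iff_eq hs hp.out).1 (hs.dvd_of_dvd_pow (h.trans hE))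
    obtain ⟨⟨_, d, hd, rfl⟩, hz⟩ := exists_prime_orderOf_dvd_card' s hsE
    rw [← Subgroup.orderOf_coe, ← Subgroup.orderOf_coe] at hz
    have hz' : orderOf (f d) = s := hz
    obtain ⟨b, l, hfb, hbl⟩ := exists_pow_map_eq f hs (hz' ▸ pow_orderOf_eq_one (f (d : G)))
    have hxd : Commute x d := (mem_centralizer_singleton_iff_commute.1 hd).symm
    have h1 := key s l _ hs hcon.2 hbl (hxd.pow_right b) (hfb ▸ d.2)
    rw [hfb] at h1
    rw [h1, orderOf_one] at hz'
    exact hs.one_lt.ne hz'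
  have := Fact.mk hr
  let R : Sylow r N := default
  obtain ⟨m, hR⟩ : ∃ m, (R : Subgroup N).index = p ^ m :=
    ⟨_, Nat.eq_prime_pow_of_unique_prime_dvd Subgroup.index_ne_zero_of_finite (by
      intro d hd hdR
      refine (hprimes d hd (hdR.trans (Subgroup.index_dvd_card _))).resolve_right ?_
      rintro rfl
      exact R.not_dvd_index hdR)⟩
  by_cases hnt : Nontrivial R
  · have hcen := R.isPGroup'.center_nontrivial
    obtain ⟨⟨z, hz⟩, hz1⟩ := exists_ne (1 : Subgroup.center R)
    refine hz1 (Subtype.ext (Subtype.ext ?_))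
    refine eq_one_of_classSize_subtype_dvd_pow hmin hperf hp.out (y := (z : N)) (k := m) ?_
    rw [← hR]
    refine Subgroup.index_dvd_of_le fun e he ↦ ?_
    rw [mem_centralizer_singleton_iff_commute]
    exact congrArg Subtype.val (Subgroup.mem_center_iff.1 hz ⟨e, he⟩)
  · rw [not_nontrivial_iff_subsingleton] at hnt
    refine hNp (IsPGroup.of_card (n := m) ?_)
    rw [← (R : Subgroup N).card_mul_index, hR,
      Nat.card_of_subsingleton (1 : (R : Subgroup N)), one_mul]

end

theorem isPGroup_commutator_of_vcs_eq {p : ℕ} [hp : Fact p.Prime] {G : Type} [Group G] [Finite G]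
    {n : ℕ} (hv : vcs G = {p ^ n}) : IsPGroup p (commutator G) := by
  by_contra hcon
  have hG : ∀ g : G, IsVanishing G g → classSize g = p ^ n := by
    intro g hg
    have h1 : classSize g ∈ vcs G := ⟨g, hg, rfl⟩
    rwa [hv] at h1
  have hbot : ∃ x ∈ commutator G, ∀ k, x ^ p ^ k ∉ (⊥ : Subgroup G) := by
    by_contra h
    push Not at h
    apply hcon
    rw [isPGroup_iff_pow_pow_eq_one]
    intro x
    obtain ⟨k, hk⟩ := h x x.2
    exact ⟨k, Subtype.ext (Subgroup.mem_bot.1 hk)⟩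
  obtain ⟨L, -, ⟨hLn, y, hy, hyL⟩, hmax⟩ := Finite.exists_le_maximal
    (p := fun L : Subgroup G ↦ L.Normal ∧ ∃ x ∈ commutator G, ∀ k, x ^ p ^ k ∉ L)
    ⟨inferInstance, hbot⟩
  have hsurj := QuotientGroup.mk'_surjective L
  have hcomm : (commutator G).map (QuotientGroup.mk' L) = commutator (G ⧸ L) := by
    rw [commutator_def, commutator_def, Subgroup.map_commutator,
      Subgroup.map_top_of_surjective _ hsurj]
  have hK : ∀ K : Subgroup (G ⧸ L), K.Normal → K ≠ ⊥ → ∀ x ∈ commutator (G ⧸ L),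
      ∃ k, x ^ p ^ k ∈ K := by
    intro K hK hK1 x hx
    rw [← hcomm] at hx
    obtain ⟨g, hg, rfl⟩ := hx
    by_contra hk
    push Not at hk
    have h1 : K.comap (QuotientGroup.mk' L) ≤ L :=
      hmax ⟨inferInstance, g, hg, fun k hk' ↦ hk k hk'⟩ (QuotientGroup.le_comap_mk' L K)
    apply hK1
    rw [eq_bot_iff]
    intro z hz
    obtain ⟨e, rfl⟩ := hsurj z
    exact (QuotientGroup.eq_one_iff _).2 (h1 hz)
  have hyc : QuotientGroup.mk' L y ∈ commutator (G ⧸ L) := hcomm ▸ ⟨y, hy, rfl⟩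
  have hy1 : ∀ k, QuotientGroup.mk' L y ^ p ^ k ≠ 1 := by
    intro k hk
    rw [← map_pow] at hk
    exact hyL k ((QuotientGroup.eq_one_iff _).1 hk)
  have hcb : commutator (G ⧸ L) ≠ ⊥ := by
    intro h
    rw [h, Subgroup.mem_bot] at hyc
    exact hy1 0 (by rw [hyc, one_pow])
  obtain ⟨N, -, ⟨hNn, hN1⟩, hNmin⟩ := Finite.exists_le_minimal
    (p := fun K : Subgroup (G ⧸ L) ↦ K.Normal ∧ K ≠ ⊥) ⟨inferInstance, hcb⟩
  have hmin : ∀ K : Subgroup (G ⧸ L), K.Normal → K ≠ ⊥ → N ≤ K := by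
    intro K hKn hK1
    refine le_trans (hNmin ⟨inferInstance, fun h ↦ ?_⟩ (inf_le_left (b := K))) inf_le_right
    obtain ⟨k, hk⟩ := hK N hNn hN1 _ hyc
    obtain ⟨l, hl⟩ := hK K hKn hK1 _ hyc
    refine hy1 (k + l) ?_
    rw [← Subgroup.mem_bot, ← h, pow_add]
    refine Subgroup.mem_inf.2 ⟨?_, ?_⟩
    · rw [pow_mul]
      exact pow_mem hk _
    · rw [mul_comm, pow_mul]
      exact pow_mem hl _
  have hNp : ¬ IsPGroup p N := by
    intro hN
    obtain ⟨k, hk⟩ := hK N hNn hN1 _ hyc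
    obtain ⟨l, hl⟩ := hN.exists_pow_eq_one hk
    refine hy1 (k + l) ?_
    rw [pow_add, pow_mul, hl]
  have hvX : ∀ g, IsVanishing (G ⧸ L) g → ∃ k, classSize g = p ^ k := by
    intro x hx
    obtain ⟨g, rfl⟩ := hsurj x
    have h1 := classSize_map_dvd _ hsurj g
    rw [hG g (hx.of_surjective _ hsurj)] at h1
    obtain ⟨k, -, hk⟩ := (Nat.dvd_prime_pow hp.out).1 h1
    exact ⟨k, hk⟩
  have hab := exists_not_commute_of_isVanishing hmin hNp (hmin _ inferInstance hcb)
    (hK N hNn hN1) hvX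
  obtain ⟨r, x, hr, hx, hxv⟩ := exists_isVanishing_orderOf_prime hmin hab hvX
  exact false_of_isVanishing_orderOf_prime hG _ hsurj hmin hNp
    (commutator_eq_top_of_not_commute hmin hab) hr hx hxv

/-- Corollary 3.4: `vcs(G) = {p^α}` iff `G = PH` with `P` a normal Sylow
`p`-subgroup, `H` an abelian `p`-complement, and (a) or (b) holds. -/
theorem statement12 (G : Type) [Group G] [Finite G] (p : ℕ) (hp : p.Prime)
    (α : ℕ) (hα : 0 < α) :
    vcs G = {p ^ α} ↔
      ∃ P H : Subgroup G, P.Normal ∧ IsPGroup p ↥P ∧ ¬ p ∣ P.index ∧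
        (∃ k : ℕ, H.index = p ^ k) ∧ ¬ p ∣ Nat.card H ∧
        IsAbelianSubgroup H ∧ P ⊔ H = ⊤ ∧
        (((∀ h ∈ H, ∀ x ∈ P, Commute h x) ∧ cs ↥P = {1, p ^ α}) ∨
         (IsFrobenius (P.map (QuotientGroup.mk' (Subgroup.center G)))
            (H.map (QuotientGroup.mk' (Subgroup.center G))) ∧
          Nat.card (P.map (QuotientGroup.mk' (Subgroup.center G))) = p ^ α ∧
          ∀ x ∈ P, ¬ IsVanishing G x)) := by
  have : Fact p.Prime := ⟨hp⟩
  constructor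
  · intro hv
    obtain ⟨P, hP⟩ := (isPGroup_commutator_of_vcs_eq hv).exists_le_sylow
    have hab : ∀ a b : G, a * b * a⁻¹ * b⁻¹ ∈ (P : Subgroup G) := fun a b ↦
      hP (Subgroup.commutator_mem_commutator (Subgroup.mem_top a) (Subgroup.mem_top b))
    have hn : (P : Subgroup G).Normal := by
      constructor
      intro a ha g
      have h1 := mul_mem (hab g a) ha
      rwa [inv_mul_cancel_right] at h1
    exact structure_of_vcs_eq (P : Subgroup G) P.isPGroup' hα P.not_dvd_index hab hv
  · rintro ⟨P, H, hn, hP, -, -, -, hH, hPH, ⟨hc, hcs⟩ | ⟨hF, hcard, hnv⟩⟩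
    · exact vcs_eq_of_isPGroup_of_commute G hp hα P H hP hH hPH hc hcs
    · exact vcs_eq_of_isFrobenius G P H hH hPH hF hcard hnv
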